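/- Let ν/λ be any skew shape in ℕ×ℕ. Then the minimal increasing tableau M_{ν/λ} has a unique rectification, and this rectification is the minimal increasing tableau M_μ of some Young diagram μ. -/

import Mathlib

open Classical

noncomputable section

/-- A straight shape in a poset: a finite lower order ideal, given as a `Finset`. -/
def StraightShape {L : Type} [PartialOrder L] (lam : Finset L) : Prop :=
  ∀ a ∈ lam, ∀ b : L, b ≤ a → b ∈ lam

/-- The shape (set of boxes) of a partially defined tableau. -/
def shapeOf {L : Type} {V : Type} (T : L → Option V) : Set L := {α | T α ≠ none}

/-- `lam ⊆ nu` is a pair of straight shapes, defining the skew shape `nu / lam`. -/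
def IsSkewPair {L : Type} [PartialOrder L] (lam nu : Finset L) : Prop :=
  StraightShape lam ∧ StraightShape nu ∧ lam ⊆ nu

/-- `T` is defined on a skew shape `nu / lam`. -/
def HasSkewShape {L : Type} [PartialOrder L] (T : L → Option ℤ) : Prop :=
  ∃ lam nu : Finset L, IsSkewPair lam nu ∧ shapeOf T = (nu : Set L) \ (lam : Set L)

/-- `T` is strictly increasing along the partial order. -/
def Increasing {L : Type} [PartialOrder L] (T : L → Option ℤ) : Prop :=
  ∀ a b : L, a < b → ∀ x y : ℤ, T a = some x → T b = some y → x < y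

/-- An increasing tableau of skew shape. -/
def IncreasingSkewTableau {L : Type} [PartialOrder L] (T : L → Option ℤ) : Prop :=
  HasSkewShape T ∧ Increasing T

/-- Two boxes are neighbors if one covers the other. -/
def Neighbor {L : Type} [PartialOrder L] (a b : L) : Prop := a ⋖ b ∨ b ⋖ a

/-- The swap operation `swap_{s,s'}`. -/
def swapVal {L : Type} [PartialOrder L] {V : Type} (s s' : V) (T : L → Option V) :
    L → Option V := fun α =>
  if T α = some s ∧ ∃ β, Neighbor α β ∧ T β = some s' then some s'
  else if T α = some s' ∧ ∃ β, Neighbor α β ∧ T β = some s then some s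
  else T α

/-- Integer values extended with a dot `•`. -/
abbrev ZDot : Type := ℤ ⊕ Unit

def toDotted {L : Type} (T : L → Option ℤ) : L → Option ZDot := fun α => (T α).map Sum.inl

/-- Place a dot in every box of `C`. -/
def addDots {L : Type} (C : Finset L) (T : L → Option ZDot) : L → Option ZDot := fun α =>
  if α ∈ C then some (Sum.inr ()) else T α

/-- Restrict a dotted tableau to its integer-valued boxes. -/
def restrictInt {L : Type} (T : L → Option ZDot) : L → Option ℤ := fun α =>
  (T α).bind (Sum.elim some fun _ => none)

/-- Apply `swap_{a,•}, swap_{a+1,•}, …, swap_{a+n-1,•}` in this (increasing) order. -/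
def swapUp {L : Type} [PartialOrder L] (a : ℤ) : ℕ → (L → Option ZDot) → (L → Option ZDot)
  | 0, T => T
  | n + 1, T => swapVal (Sum.inl (a + n)) (Sum.inr ()) (swapUp a n T)

/-- Apply `swap_{b,•}, swap_{b-1,•}, …, swap_{b-n+1,•}` in this (decreasing) order. -/
def swapDown {L : Type} [PartialOrder L] (b : ℤ) : ℕ → (L → Option ZDot) → (L → Option ZDot)
  | 0, T => T
  | n + 1, T => swapVal (Sum.inl (b - n)) (Sum.inr ()) (swapDown b n T)

/-- All values of `T` lie in the interval `[a, b]`. -/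
def ValuesIn {L : Type} (T : L → Option ℤ) (a b : ℤ) : Prop :=
  ∀ (α : L) (x : ℤ), T α = some x → a ≤ x ∧ x ≤ b

/-- `T'` is obtained from `T` by a single forward jeu de taquin slide `jdt_C`,
starting from a set `C` of maximal boxes of the inner shape. -/
def IsForwardSlide {L : Type} [PartialOrder L] (T T' : L → Option ℤ) : Prop :=
  ∃ (lam nu C : Finset L) (a b : ℤ),
    IsSkewPair lam nu ∧ shapeOf T = (nu : Set L) \ (lam : Set L) ∧ ValuesIn T a b ∧
    (∀ c ∈ C, c ∈ lam ∧ ∀ d ∈ lam, ¬ c < d) ∧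
    T' = restrictInt (swapUp a (b - a + 1).toNat (addDots C (toDotted T)))

/-- `T'` is obtained from `T` by a single reverse jeu de taquin slide,
starting from a set `C` of minimal boxes of the complement of the outer shape. -/
def IsReverseSlide {L : Type} [PartialOrder L] (T T' : L → Option ℤ) : Prop :=
  ∃ (lam nu C : Finset L) (a b : ℤ),
    IsSkewPair lam nu ∧ shapeOf T = (nu : Set L) \ (lam : Set L) ∧ ValuesIn T a b ∧
    (∀ c ∈ C, c ∉ nu ∧ ∀ d : L, d ∉ nu → ¬ d < c) ∧
    T' = restrictInt (swapDown b (b - a + 1).toNat (addDots C (toDotted T)))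

/-- Jeu de taquin equivalence: a finite sequence of forward and reverse slides. -/
def JdtEquiv {L : Type} [PartialOrder L] (T T' : L → Option ℤ) : Prop :=
  Relation.ReflTransGen (fun A B => IsForwardSlide A B ∨ IsReverseSlide A B) T T'

/-- `T` is defined on a straight shape. -/
def HasStraightShape {L : Type} [PartialOrder L] (T : L → Option ℤ) : Prop :=
  ∃ lam : Finset L, StraightShape lam ∧ shapeOf T = (lam : Set L)

/-- `U` is a rectification of `T`: a straight-shape tableau obtained by forward slides. -/
def RectifiesTo {L : Type} [PartialOrder L] (T U : L → Option ℤ) : Prop :=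
  Relation.ReflTransGen IsForwardSlide T U ∧ HasStraightShape U

/-- Unique rectification target. -/
def IsURT {L : Type} [PartialOrder L] (U : L → Option ℤ) : Prop :=
  HasStraightShape U ∧ Increasing U ∧
    ∀ T : L → Option ℤ, IncreasingSkewTableau T → RectifiesTo T U →
      ∀ U' : L → Option ℤ, RectifiesTo T U' → U' = U

/-- The minimal increasing tableau of a shape `θ`: each box `α` receives the maximal
cardinality of a totally ordered subset of `θ` having `α` as its maximal element. -/
def minTab {L : Type} [PartialOrder L] (θ : Finset L) : L → Option ℤ := fun α =>
  if α ∈ θ then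
    some ((sSup {n : ℕ | ∃ s : Finset L, (s : Set L) ⊆ (θ : Set L) ∧
      (∀ a ∈ s, ∀ b ∈ s, a ≤ b ∨ b ≤ a) ∧ α ∈ s ∧ (∀ a ∈ s, a ≤ α) ∧ s.card = n} : ℕ) : ℤ)
  else none

/-- A unique rectification poset. -/
def IsURP (L : Type) [PartialOrder L] : Prop :=
  ∀ lam : Finset L, StraightShape lam → IsURT (minTab lam)

/-- The structure constant `c^ν_{λ,μ}`: the number of increasing tableaux of
shape `ν/λ` that have the minimal increasing tableau `M_μ` as a rectification. -/
def ccoef {L : Type} [PartialOrder L] (lam mu nu : Finset L) : ℕ :=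
  Set.ncard {T : L → Option ℤ | Increasing T ∧ shapeOf T = (nu : Set L) \ (lam : Set L) ∧
    RectifiesTo T (minTab mu)}


/-- The defining relations of the 0-Hecke monoid, for a family of elements indexed by `ℤ`. -/
structure HeckeRel {M : Type} [Monoid M] (g : ℤ → M) : Prop where
  idem : ∀ i, g i * g i = g i
  comm : ∀ i j, i + 2 ≤ j → Commute (g i) (g j)
  braid : ∀ i, g i * g (i + 1) * g i = g (i + 1) * g i * g (i + 1)

/-- The product of the generators indexed by a finite set of integers, in decreasing order. -/
def descProd {M : Type} [Monoid M] (g : ℤ → M) (S : Set ℤ) : M :=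
  if h : S.Finite then ((h.toFinset.sort (· ≥ ·)).map g).prod else 1

section descProd

variable {M : Type} [Monoid M] {g : ℤ → M}

theorem descProd_empty : descProd g ∅ = 1 := by
  simp [descProd]

theorem sort_ge_split (S : Finset ℤ) (k : ℤ) :
    S.sort (· ≥ ·) = (S.filter (k < ·)).sort (· ≥ ·) ++ (if k ∈ S then [k] else []) ++
      (S.filter (· < k)).sort (· ≥ ·) := by
  refine List.Perm.eq_of_pairwise' (r := (· ≥ ·)) (S.pairwise_sort _) ?_ ?_
  · rw [List.pairwise_append, List.pairwise_append]
    refine ⟨⟨Finset.pairwise_sort _ _, by split_ifs <;> simp, ?_⟩, Finset.pairwise_sort _ _, ?_⟩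
    · intro a ha b hb
      split_ifs at hb <;> simp at ha hb
      omega
    · intro a ha b hb
      simp only [List.mem_append, Finset.mem_sort, Finset.mem_filter] at ha hb
      rcases ha with ha | ha
      · omega
      · split_ifs at ha <;> simp at ha
        omega
  · refine (List.perm_ext_iff_of_nodup (S.sort_nodup _) ?_).2 ?_
    · rw [List.nodup_append, List.nodup_append]
      refine ⟨⟨Finset.sort_nodup _ _, by split_ifs <;> simp, ?_⟩, Finset.sort_nodup _ _, ?_⟩
      · intro a ha b hb
        split_ifs at hb <;> simp at ha hb
        omega
      · intro a ha b hb
        simp only [List.mem_append, Finset.mem_sort, Finset.mem_filter] at ha hb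
        rcases ha with ha | ha
        · omega
        · split_ifs at ha <;> simp at ha
          omega
    · intro a
      simp only [List.mem_append, Finset.mem_sort, Finset.mem_filter]
      by_cases hk : k ∈ S <;> simp only [hk, if_true, if_false, List.mem_singleton, List.not_mem_nil]
      · constructor
        · intro h
          rcases lt_trichotomy a k with h' | h' | h' <;> simp_all
        · rintro ((h | h) | h)
          exacts [h.1, h ▸ hk, h.1]
      · constructor
        · intro h
          have : a ≠ k := by rintro rfl; exact hk h
          rcases lt_or_gt_of_ne this with h' | h' <;> simp_all
        · rintro ((h | h) | h)
          exacts [h.1, h.elim, h.1]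

theorem descProd_split {S : Set ℤ} (hS : S.Finite) (k : ℤ) :
    descProd g S = descProd g (S ∩ Set.Ioi k) * (if k ∈ S then g k else 1) *
      descProd g (S ∩ Set.Iio k) := by
  have h1 : (S ∩ Set.Ioi k).Finite := hS.inter_of_left _
  have h2 : (S ∩ Set.Iio k).Finite := hS.inter_of_left _
  have e1 : h1.toFinset = hS.toFinset.filter (k < ·) := by ext; simp
  have e2 : h2.toFinset = hS.toFinset.filter (· < k) := by ext; simp
  rw [descProd, descProd, descProd, dif_pos hS, dif_pos h1, dif_pos h2, sort_ge_split _ k, e1, e2]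
  by_cases hk : k ∈ S <;> simp [hk, mul_assoc]

theorem commute_descProd {S : Set ℤ} {x : M} (h : ∀ v ∈ S, Commute x (g v)) :
    Commute x (descProd g S) := by
  unfold descProd
  split_ifs with hS
  · refine Commute.list_prod_right _ _ ?_
    intro y hy
    simp only [List.mem_map, Finset.mem_sort, Set.Finite.mem_toFinset] at hy
    obtain ⟨v, hv, rfl⟩ := hy
    exact h v hv
  · exact Commute.one_right _

theorem descProd_mul_inter_Iio_of_mem {S : Set ℤ} (hS : S.Finite) {k : ℤ}
    (hk : k ∈ S) (hmax : ∀ v ∈ S, v ≤ k) :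
    descProd g S = g k * descProd g (S ∩ Set.Iio k) := by
  rw [descProd_split hS k, if_pos hk]
  have : S ∩ Set.Ioi k = ∅ := by
    ext v
    simp only [Set.mem_inter_iff, Set.mem_Ioi, Set.mem_empty_iff_false, iff_false, not_and, not_lt]
    exact hmax v
  rw [this, descProd_empty, one_mul]

end descProd

/-- Shifting the second family of factors by one across a product. -/
theorem mul_prod_range_shift {M : Type} [Monoid M] (v y : ℕ → M) (n : ℕ) :
    v 0 * ((List.range n).map fun j => y j * v (j + 1)).prod =
      ((List.range n).map fun j => v j * y j).prod * v n := by
  induction n with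
  | zero => simp
  | succ n ih =>
    rw [List.prod_range_succ, List.prod_range_succ, ← mul_assoc, ih]
    simp only [mul_assoc]

section columnBoundary

variable {M : Type} [Monoid M] {g : ℤ → M}

/-- The rearrangement at the boundary of two adjacent columns before the value `k` is swapped. -/
theorem boundary_before (hg : HeckeRel g) {k : ℤ} {L H : Set ℤ} (hL : L.Finite)
    (hLk : ∀ v ∈ L, v < k) (hHk : ∀ v ∈ H, k < v) {sq e v K : Prop}
    (hK : K ↔ v ∨ e) (hsq : sq → e ∧ v ∧ k - 1 ∈ L) (hn : ¬ sq → e → k - 1 ∉ L) :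
    (if sq then g (k - 1) * (descProd g H * (if K then g k else 1)) * descProd g L
      else descProd g L * (descProd g H * (if K then g k else 1))) =
    descProd g H * (if e then g k else 1) * descProd g L * (if v then g k else 1) := by
  have cLH : Commute (descProd g L) (descProd g H) := by
    refine commute_descProd fun w hw => (commute_descProd fun u hu => ?_).symm
    exact (hg.comm _ _ (by have := hLk u hu; have := hHk w hw; omega)).symm
  by_cases hs : sq
  · obtain ⟨he, hv, hm⟩ := hsq hs
    have hKt : K := hK.2 (Or.inl hv)
    simp only [hs, he, hv, hKt, if_true]
    have cH : Commute (g (k - 1)) (descProd g H) :=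
      commute_descProd fun w hw => hg.comm _ _ (by have := hHk w hw; omega)
    rw [descProd_mul_inter_Iio_of_mem hL hm (fun w hw => by have := hLk w hw; omega)]
    have cL : Commute (g k) (descProd g (L ∩ Set.Iio (k - 1))) :=
      commute_descProd fun w hw => (hg.comm _ _ (by have := hw.2; simp at this; omega)).symm
    have br := hg.braid (k - 1)
    rw [sub_add_cancel] at br
    generalize descProd g (L ∩ Set.Iio (k - 1)) = l at *
    generalize descProd g H = h at *
    calc g (k - 1) * (h * g k) * (g (k - 1) * l)
        = (g (k - 1) * h) * (g k * g (k - 1) * l) := by simp only [mul_assoc]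
      _ = h * (g (k - 1) * g k * g (k - 1)) * l := by rw [cH.eq]; simp only [mul_assoc]
      _ = h * g k * g (k - 1) * (g k * l) := by rw [br]; simp only [mul_assoc]
      _ = _ := by rw [cL.eq]; simp only [mul_assoc]
  · simp only [hs, if_false]
    by_cases he : e
    · have hKt : K := hK.2 (Or.inr he)
      have hm := hn hs he
      have cL : Commute (g k) (descProd g L) :=
        commute_descProd fun w hw => (hg.comm _ _ (by
          have := hLk w hw
          have : w ≠ k - 1 := by rintro rfl; exact hm hw
          omega)).symm
      simp only [he, hKt, if_true]
      have e1 : descProd g L * (descProd g H * g k) = descProd g H * g k * descProd g L := by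
        rw [← mul_assoc, cLH.eq, mul_assoc, ← cL.eq, mul_assoc]
      rw [e1]
      by_cases hv : v
      · simp only [hv, if_true]
        rw [mul_assoc _ _ (g k), ← cL.eq, ← mul_assoc, mul_assoc _ (g k) (g k), hg.idem]
      · simp [hv]
    · have hKv : K ↔ v := by simp [hK, he]
      simp only [he, hKv, if_false, mul_one]
      rw [← mul_assoc, cLH.eq]

/-- The rearrangement at the boundary of two adjacent columns after the value `k` is swapped. -/
theorem boundary_after (hg : HeckeRel g) {k : ℤ} {L H : Set ℤ}
    (hLk : ∀ v ∈ L, v < k) (hHk : ∀ v ∈ H, k < v) {sq e v K : Prop}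
    (hK : K ↔ v ∨ e) (hsq : sq → e ∧ v) (hn : ¬ sq → e → k + 1 ∉ H) :
    (if v then g k else 1) * (descProd g H * (if e then g k else 1) * descProd g L) =
    (if sq then g k * descProd g H * ((if K then g k else 1) * descProd g L)
      else (if K then g k else 1) * descProd g L * descProd g H) := by
  have cLH : Commute (descProd g L) (descProd g H) := by
    refine commute_descProd fun w hw => (commute_descProd fun u hu => ?_).symm
    exact (hg.comm _ _ (by have := hLk u hu; have := hHk w hw; omega)).symm
  by_cases hs : sq
  · obtain ⟨he, hv⟩ := hsq hs
    have hKt : K := hK.2 (Or.inl hv)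
    simp only [hs, he, hv, hKt, if_true, mul_assoc]
  · simp only [hs, if_false]
    by_cases he : e
    · have hKt : K := hK.2 (Or.inr he)
      have hm := hn hs he
      have cH : Commute (g k) (descProd g H) :=
        commute_descProd fun w hw => hg.comm _ _ (by
          have := hHk w hw
          have : w ≠ k + 1 := by rintro rfl; exact hm hw
          omega)
      simp only [he, hKt, if_true]
      have e1 : descProd g H * g k * descProd g L = g k * descProd g L * descProd g H := by
        rw [← cH.eq, mul_assoc, ← cLH.eq, mul_assoc]
      rw [e1]
      by_cases hv : v
      · simp only [hv, if_true]
        rw [← mul_assoc, ← mul_assoc, hg.idem]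
      · simp [hv]
    · have hKv : K ↔ v := by simp [hK, he]
      simp only [he, hKv, if_false, mul_one]
      rw [← cLH.eq, mul_assoc]

end columnBoundary



theorem descProd_inter_Ici {M : Type} [Monoid M] {g : ℤ → M} {S : Set ℤ} (hS : S.Finite) (k : ℤ) :
    descProd g (S ∩ Set.Ici k) = descProd g (S ∩ Set.Ioi k) * (if k ∈ S then g k else 1) := by
  have e1 : S ∩ Set.Ici k ∩ Set.Ioi k = S ∩ Set.Ioi k := by
    ext v; simp only [Set.mem_inter_iff, Set.mem_Ici, Set.mem_Ioi]; grind
  have e2 : S ∩ Set.Ici k ∩ Set.Iio k = ∅ := by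
    ext v; simp only [Set.mem_inter_iff, Set.mem_Ici, Set.mem_Iio, Set.mem_empty_iff_false]; grind
  rw [descProd_split (hS.inter_of_left _) k, e1, e2, descProd_empty]
  simp

theorem descProd_inter_Iio_add_one {M : Type} [Monoid M] {g : ℤ → M} {S : Set ℤ} (hS : S.Finite)
    (k : ℤ) :
    descProd g (S ∩ Set.Iio (k + 1)) =
      (if k ∈ S then g k else 1) * descProd g (S ∩ Set.Iio k) := by
  have e1 : S ∩ Set.Iio (k + 1) ∩ Set.Ioi k = ∅ := by
    ext v; simp only [Set.mem_inter_iff, Set.mem_Iio, Set.mem_Ioi, Set.mem_empty_iff_false]; grind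
  have e2 : S ∩ Set.Iio (k + 1) ∩ Set.Iio k = S ∩ Set.Iio k := by
    ext v; simp only [Set.mem_inter_iff, Set.mem_Iio]; grind
  rw [descProd_split (hS.inter_of_left _) k, e1, e2, descProd_empty]
  simp

section dotted

/-- The position of an entry in the total order in force just before `swap_{k,•}`,
where the dot stands immediately below `k`. -/
def dotRank (k : ℤ) : ZDot → ℤ := Sum.elim (fun x => 2 * x) fun _ => 2 * k - 1

@[simp] theorem dotRank_inl (k x : ℤ) : dotRank k (Sum.inl x) = 2 * x := rfl

@[simp] theorem dotRank_inr (k : ℤ) (u : Unit) : dotRank k (Sum.inr u) = 2 * k - 1 := rfl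

/-- A dotted tableau to which `swap_{k,•}` is about to be applied. -/
structure IsStage (k : ℤ) (D : ℕ × ℕ → Option ZDot) : Prop where
  fin : (shapeOf D).Finite
  convex : ∀ a b c, a ≤ b → b ≤ c → D a ≠ none → D c ≠ none → D b ≠ none
  mono : ∀ a b, a < b → ∀ x y, D a = some x → D b = some y → dotRank k x < dotRank k y

theorem exists_succ_le_of_lt {i j i' j' : ℕ} (h : (i, j) < (i', j')) :
    ((i, j) < (i + 1, j) ∧ (i + 1, j) ≤ (i', j')) ∨ ((i, j) < (i, j + 1) ∧ (i, j + 1) ≤ (i', j')) := by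
  simp only [Prod.mk_lt_mk, Prod.mk_le_mk] at *
  omega

theorem neighbor_iff (i j : ℕ) (b : ℕ × ℕ) :
    Neighbor (i, j) b ↔ b = (i + 1, j) ∨ b = (i, j + 1) ∨ (b.1 + 1 = i ∧ b.2 = j) ∨
      (b.1 = i ∧ b.2 + 1 = j) := by
  obtain ⟨i', j'⟩ := b
  simp only [Neighbor, Prod.mk_covBy_mk_iff, Order.covBy_iff_add_one_eq, Prod.mk.injEq]
  omega

variable {k : ℤ} {D : ℕ × ℕ → Option ZDot}

theorem IsStage.lt_succ_row (h : IsStage k D) {i j : ℕ} {x y : ZDot} (hx : D (i, j) = some x)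
    (hy : D (i + 1, j) = some y) : dotRank k x < dotRank k y :=
  h.mono _ _ (by simp) _ _ hx hy

theorem IsStage.lt_succ_col (h : IsStage k D) {i j : ℕ} {x y : ZDot} (hx : D (i, j) = some x)
    (hy : D (i, j + 1) = some y) : dotRank k x < dotRank k y :=
  h.mono _ _ (by simp) _ _ hx hy

theorem IsStage.swap_of_dot (h : IsStage k D) {i j : ℕ} (hp : D (i, j) = some (Sum.inr ())) :
    swapVal (Sum.inl k) (Sum.inr ()) D (i, j) =
      if D (i + 1, j) = some (Sum.inl k) ∨ D (i, j + 1) = some (Sum.inl k)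
        then some (Sum.inl k) else some (Sum.inr ()) := by
  have hiff : (∃ β, Neighbor (i, j) β ∧ D β = some (Sum.inl k)) ↔
      (D (i + 1, j) = some (Sum.inl k) ∨ D (i, j + 1) = some (Sum.inl k)) := by
    constructor
    · rintro ⟨⟨i', j'⟩, hn, hb⟩
      rw [neighbor_iff] at hn
      simp only [Prod.mk.injEq] at hn
      rcases hn with ⟨rfl, rfl⟩ | ⟨rfl, rfl⟩ | ⟨rfl, rfl⟩ | ⟨rfl, rfl⟩
      · exact Or.inl hb
      · exact Or.inr hb
      · have := h.lt_succ_row hb hp; simp at this; omega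
      · have := h.lt_succ_col hb hp; simp at this; omega
    · rintro (hb | hb)
      · exact ⟨_, (neighbor_iff _ _ _).2 (Or.inl rfl), hb⟩
      · exact ⟨_, (neighbor_iff _ _ _).2 (Or.inr (Or.inl rfl)), hb⟩
  simp only [swapVal, hp, hiff]
  simp

theorem IsStage.swap_of_inl (h : IsStage k D) {i j : ℕ} (hp : D (i, j) = some (Sum.inl k)) :
    swapVal (Sum.inl k) (Sum.inr ()) D (i, j) =
      if (∃ i', i = i' + 1 ∧ D (i', j) = some (Sum.inr ())) ∨
          (∃ j', j = j' + 1 ∧ D (i, j') = some (Sum.inr ()))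
        then some (Sum.inr ()) else some (Sum.inl k) := by
  have hiff : (∃ β, Neighbor (i, j) β ∧ D β = some (Sum.inr ())) ↔
      ((∃ i', i = i' + 1 ∧ D (i', j) = some (Sum.inr ())) ∨
          (∃ j', j = j' + 1 ∧ D (i, j') = some (Sum.inr ()))) := by
    constructor
    · rintro ⟨⟨i', j'⟩, hn, hb⟩
      rw [neighbor_iff] at hn
      simp only [Prod.mk.injEq] at hn
      rcases hn with ⟨rfl, rfl⟩ | ⟨rfl, rfl⟩ | ⟨rfl, rfl⟩ | ⟨rfl, rfl⟩
      · have := h.lt_succ_row hp hb; simp at this; omega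
      · have := h.lt_succ_col hp hb; simp at this; omega
      · exact Or.inl ⟨_, rfl, hb⟩
      · exact Or.inr ⟨_, rfl, hb⟩
    · rintro (⟨i', rfl, hb⟩ | ⟨j', rfl, hb⟩)
      · exact ⟨_, (neighbor_iff _ _ _).2 (Or.inr (Or.inr (Or.inl ⟨rfl, rfl⟩))), hb⟩
      · exact ⟨_, (neighbor_iff _ _ _).2 (Or.inr (Or.inr (Or.inr ⟨rfl, rfl⟩))), hb⟩
  simp only [swapVal, hp, hiff]
  simp

theorem swapVal_eq_inl_iff {w : ℤ} (hw : w ≠ k) (p : ℕ × ℕ) :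
    swapVal (Sum.inl k) (Sum.inr ()) D p = some (Sum.inl w) ↔ D p = some (Sum.inl w) := by
  unfold swapVal
  split_ifs with h1 h2
  · rw [h1.1]; simp [hw.symm]
  · rw [h2.1]; simp [hw.symm]
  · rfl

theorem swapVal_eq_none_iff (p : ℕ × ℕ) :
    swapVal (Sum.inl k) (Sum.inr ()) D p = none ↔ D p = none := by
  unfold swapVal
  split_ifs with h1 h2
  · rw [h1.1]; simp
  · rw [h2.1]; simp
  · rfl

theorem shapeOf_swapVal :
    shapeOf (swapVal (Sum.inl k) (Sum.inr ()) D) = shapeOf D := by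
  ext p
  simp [shapeOf, swapVal_eq_none_iff]

/-- A dot below a larger `k` is adjacent to it. -/
theorem IsStage.adjacent (h : IsStage k D) {i j i' j' : ℕ} (hlt : (i, j) < (i', j'))
    (hd : D (i, j) = some (Sum.inr ())) (hk : D (i', j') = some (Sum.inl k)) :
    (i', j') = (i + 1, j) ∨ (i', j') = (i, j + 1) := by
  have key : ∀ c : ℕ × ℕ, (i, j) < c → c ≤ (i', j') → (i', j') = c := by
    intro c h1 h2
    by_contra hne
    have h3 : c < (i', j') := lt_of_le_of_ne h2 (Ne.symm hne)
    have hc : D c ≠ none := h.convex _ _ _ h1.le h2 (by simp [hd]) (by simp [hk])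
    obtain ⟨x, hx⟩ := Option.ne_none_iff_exists'.1 hc
    have e1 := h.mono _ _ h1 _ _ hd hx
    have e2 := h.mono _ _ h3 _ _ hx hk
    simp at e1 e2
    omega
  rcases exists_succ_le_of_lt hlt with ⟨h1, h2⟩ | ⟨h1, h2⟩
  · exact Or.inl (key _ h1 h2)
  · exact Or.inr (key _ h1 h2)

theorem swapVal_cases (p : ℕ × ℕ) {y : ZDot}
    (hy : swapVal (Sum.inl k) (Sum.inr ()) D p = some y) :
    (∃ x : ℤ, x ≠ k ∧ y = Sum.inl x ∧ D p = some (Sum.inl x)) ∨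
    ((y = Sum.inl k ∨ y = Sum.inr ()) ∧ (D p = some (Sum.inl k) ∨ D p = some (Sum.inr ()))) := by
  unfold swapVal at hy
  split_ifs at hy with h1 h2
  · simp_all
  · simp_all
  · obtain x | u := y
    · by_cases hx : x = k
      · subst hx; simp [hy]
      · exact Or.inl ⟨x, hx, rfl, hy⟩
    · simp_all

theorem IsStage.swap (h : IsStage k D) :
    IsStage (k + 1) (swapVal (Sum.inl k) (Sum.inr ()) D) where
  fin := by rw [shapeOf_swapVal]; exact h.fin
  convex a b c hab hbc := by
    simp only [ne_eq, swapVal_eq_none_iff]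
    exact h.convex a b c hab hbc
  mono := by
    rintro ⟨i, j⟩ ⟨i', j'⟩ hlt x y hx hy
    rcases swapVal_cases _ hx with ⟨x', hx1, rfl, hx2⟩ | ⟨hx1, hx2⟩ <;>
    rcases swapVal_cases _ hy with ⟨y', hy1, rfl, hy2⟩ | ⟨hy1, hy2⟩
    · exact h.mono _ _ hlt _ _ hx2 hy2
    · have : dotRank k (Sum.inl x') < 2 * k := by
        rcases hy2 with hy2 | hy2 <;> have := h.mono _ _ hlt _ _ hx2 hy2 <;> simp at this ⊢ <;> omega
      rcases hy1 with rfl | rfl <;> simp at this ⊢ <;> omega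
    · have : 2 * k - 1 < dotRank k (Sum.inl y') := by
        rcases hx2 with hx2 | hx2 <;> have := h.mono _ _ hlt _ _ hx2 hy2 <;> simp at this ⊢ <;> omega
      rcases hx1 with rfl | rfl <;> simp at this ⊢ <;> omega
    · have hd : D (i, j) = some (Sum.inr ()) ∧ D (i', j') = some (Sum.inl k) := by
        rcases hx2 with hx2 | hx2 <;> rcases hy2 with hy2 | hy2 <;>
          have := h.mono _ _ hlt _ _ hx2 hy2 <;> simp at this <;>
          first | exact ⟨hx2, hy2⟩ | omega
      obtain ⟨hd, hk⟩ := hd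
      rw [h.swap_of_dot hd] at hx
      rw [h.swap_of_inl hk] at hy
      rcases h.adjacent hlt hd hk with e | e <;> simp only [Prod.mk.injEq] at e <;>
        obtain ⟨rfl, rfl⟩ := e
      · rw [if_pos (Or.inl hk)] at hx
        rw [if_pos (Or.inl ⟨_, rfl, hd⟩)] at hy
        cases hx; cases hy; simp; omega
      · rw [if_pos (Or.inr hk)] at hx
        rw [if_pos (Or.inr ⟨_, rfl, hd⟩)] at hy
        cases hx; cases hy; simp; omega

/-- The integers in a column of a dotted tableau. -/
def dotCol (D : ℕ × ℕ → Option ZDot) (j : ℕ) : Set ℤ := {v | ∃ i, D (i, j) = some (Sum.inl v)}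

/-- A square with entries `k`, `•`, `•`, `k + 1` in columns `j` and `j + 1`. -/
def HasDotSquare (k : ℤ) (D : ℕ × ℕ → Option ZDot) (j : ℕ) : Prop :=
  ∃ i, D (i, j) = some (Sum.inl k) ∧ D (i + 1, j) = some (Sum.inr ()) ∧
    D (i, j + 1) = some (Sum.inr ()) ∧ D (i + 1, j + 1) = some (Sum.inl (k + 1))

/-- A dot in column `j` has `k` to its right. -/
def MovesLeft (k : ℤ) (D : ℕ × ℕ → Option ZDot) (j : ℕ) : Prop :=
  ∃ i, D (i, j) = some (Sum.inr ()) ∧ D (i, j + 1) = some (Sum.inl k)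

/-- The value `k` of column `j` remains in column `j` under `swap_{k,•}`. -/
def StaysInCol (k : ℤ) (D : ℕ × ℕ → Option ZDot) (j : ℕ) : Prop :=
  ∃ i, D (i, j) = some (Sum.inl k) ∧ ((∃ i', i = i' + 1 ∧ D (i', j) = some (Sum.inr ())) ∨
    ¬ ∃ j', j = j' + 1 ∧ D (i, j') = some (Sum.inr ()))

theorem mem_dotCol_zero_iff : k ∈ dotCol D 0 ↔ StaysInCol k D 0 := by
  simp [dotCol, StaysInCol]

theorem mem_dotCol_succ_iff (j : ℕ) :
    k ∈ dotCol D (j + 1) ↔ StaysInCol k D (j + 1) ∨ MovesLeft k D j := by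
  constructor
  · rintro ⟨i, hi⟩
    by_cases hd : D (i, j) = some (Sum.inr ())
    · exact Or.inr ⟨i, hd, hi⟩
    · refine Or.inl ⟨i, hi, Or.inr ?_⟩
      rintro ⟨j', hj, h⟩
      obtain rfl : j = j' := by omega
      exact hd h
  · rintro (⟨i, hi, -⟩ | ⟨i, -, hi⟩) <;> exact ⟨i, hi⟩

theorem IsStage.mem_dotCol_swap_iff (h : IsStage k D) (j : ℕ) :
    k ∈ dotCol (swapVal (Sum.inl k) (Sum.inr ()) D) j ↔ StaysInCol k D j ∨ MovesLeft k D j := by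
  constructor
  · rintro ⟨i, hi⟩
    rcases swapVal_cases _ hi with ⟨x', hx1, hx2, -⟩ | ⟨-, hd | hd⟩
    · simp at hx2; omega
    · rw [h.swap_of_inl hd] at hi
      split_ifs at hi with hc
      · simp at hi
      · exact Or.inl ⟨i, hd, Or.inr fun hj => hc (Or.inr hj)⟩
    · rw [h.swap_of_dot hd] at hi
      split_ifs at hi with hc
      · rcases hc with hc | hc
        · exact Or.inl ⟨i + 1, hc, Or.inl ⟨i, rfl, hd⟩⟩
        · exact Or.inr ⟨i, hd, hc⟩
      · simp at hi
  · rintro (⟨i, hi, hc⟩ | ⟨i, hd, hi⟩)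
    · by_cases hab : ∃ i', i = i' + 1 ∧ D (i', j) = some (Sum.inr ())
      · obtain ⟨i', rfl, hd⟩ := hab
        exact ⟨i', by rw [h.swap_of_dot hd, if_pos (Or.inl hi)]⟩
      · refine ⟨i, ?_⟩
        rw [h.swap_of_inl hi, if_neg]
        rintro (h' | h')
        · exact hab h'
        · exact (hc.resolve_left hab) h'
    · exact ⟨i, by rw [h.swap_of_dot hd, if_pos (Or.inr hi)]⟩

theorem mem_dotCol_swap_of_ne {w : ℤ} (hw : w ≠ k) (j : ℕ) :
    w ∈ dotCol (swapVal (Sum.inl k) (Sum.inr ()) D) j ↔ w ∈ dotCol D j := by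
  simp [dotCol, swapVal_eq_inl_iff hw]

theorem HasDotSquare.before {j : ℕ} (h : HasDotSquare (k - 1) D j) :
    MovesLeft k D j ∧ StaysInCol k D (j + 1) ∧ k - 1 ∈ dotCol D j := by
  obtain ⟨i, h1, h2, h3, h4⟩ := h
  rw [sub_add_cancel] at h4
  exact ⟨⟨i + 1, h2, h4⟩, ⟨i + 1, h4, Or.inl ⟨i, rfl, h3⟩⟩, i, h1⟩

theorem IsStage.hasDotSquare_before (h : IsStage k D) {j : ℕ} (he : MovesLeft k D j)
    (hk : k - 1 ∈ dotCol D j) : HasDotSquare (k - 1) D j := by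
  obtain ⟨i, hd, hr⟩ := he
  obtain ⟨i', hl⟩ := hk
  have hlt : i' < i := by
    rcases lt_trichotomy i' i with h' | rfl | h'
    · exact h'
    · rw [hd] at hl; simp at hl
    · have := h.mono (i, j) (i', j) (by simpa using h') _ _ hd hl
      simp at this
  have hc : D (i' + 1, j) ≠ none :=
    h.convex (i', j) (i' + 1, j) (i, j) (by simp) (by simpa using hlt) (by simp [hl]) (by simp [hd])
  obtain rfl : i = i' + 1 := by
    by_contra hne
    obtain ⟨x, hx⟩ := Option.ne_none_iff_exists'.1 hc
    have e1 := h.lt_succ_row hl hx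
    have e2 := h.mono (i' + 1, j) (i, j) (by simp; omega) _ _ hx hd
    simp at e1 e2; omega
  have hc2 : D (i', j + 1) ≠ none :=
    h.convex (i', j) (i', j + 1) (i' + 1, j + 1) (by simp) (by simp) (by simp [hl]) (by simp [hr])
  obtain ⟨x, hx⟩ := Option.ne_none_iff_exists'.1 hc2
  have e1 := h.lt_succ_col hl hx
  have e2 := h.lt_succ_row hx hr
  obtain x | ⟨⟩ := x
  · simp at e1 e2; omega
  · exact ⟨i', hl, hd, hx, by rw [sub_add_cancel]; exact hr⟩

theorem IsStage.hasDotSquare_after (h : IsStage k D) {j : ℕ}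
    (hs : HasDotSquare k (swapVal (Sum.inl k) (Sum.inr ()) D) j) :
    MovesLeft k D j ∧ StaysInCol k D j := by
  obtain ⟨i, h1, h2, h3, -⟩ := hs
  have a1 : D (i, j) = some (Sum.inl k) ∨ D (i, j) = some (Sum.inr ()) := by
    rcases swapVal_cases _ h1 with ⟨x', hx1, hx2, -⟩ | ⟨-, hd⟩
    · simp at hx2; omega
    · exact hd
  have a2 : D (i + 1, j) = some (Sum.inl k) ∨ D (i + 1, j) = some (Sum.inr ()) := by
    rcases swapVal_cases _ h2 with ⟨x', hx1, hx2, -⟩ | ⟨-, hd⟩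
    · simp at hx2
    · exact hd
  have a3 : D (i, j + 1) = some (Sum.inl k) ∨ D (i, j + 1) = some (Sum.inr ()) := by
    rcases swapVal_cases _ h3 with ⟨x', hx1, hx2, -⟩ | ⟨-, hd⟩
    · simp at hx2
    · exact hd
  have b2 : D (i, j) = some (Sum.inr ()) ∧ D (i + 1, j) = some (Sum.inl k) := by
    rcases a1 with a1 | a1 <;> rcases a2 with a2 | a2 <;> have := h.lt_succ_row a1 a2 <;>
      simp at this <;> first | exact ⟨a1, a2⟩ | omega
  have b3 : D (i, j + 1) = some (Sum.inl k) := by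
    rcases a3 with a3 | a3
    · exact a3
    · have := h.lt_succ_col b2.1 a3; simp at this
  exact ⟨⟨i, b2.1, b3⟩, ⟨i + 1, b2.2, Or.inl ⟨i, rfl, b2.1⟩⟩⟩

theorem IsStage.hasDotSquare_swap (h : IsStage k D) {j : ℕ} (he : MovesLeft k D j)
    (hk : k + 1 ∈ dotCol D (j + 1)) : HasDotSquare k (swapVal (Sum.inl k) (Sum.inr ()) D) j := by
  obtain ⟨i, hd, hr⟩ := he
  obtain ⟨i', hl⟩ := hk
  have hlt : i < i' := by
    rcases lt_trichotomy i i' with h' | rfl | h'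
    · exact h'
    · rw [hr] at hl; simp at hl
    · have := h.mono (i', j + 1) (i, j + 1) (by simpa using h') _ _ hl hr
      simp at this
  have hc : D (i + 1, j + 1) ≠ none :=
    h.convex (i, j + 1) (i + 1, j + 1) (i', j + 1) (by simp) (by simpa using hlt) (by simp [hr])
      (by simp [hl])
  obtain rfl : i' = i + 1 := by
    by_contra hne
    obtain ⟨x, hx⟩ := Option.ne_none_iff_exists'.1 hc
    have e1 := h.lt_succ_row hr hx
    have e2 := h.mono (i + 1, j + 1) (i', j + 1) (by simp; omega) _ _ hx hl
    obtain x | ⟨⟩ := x <;> simp at e1 e2 <;> omega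
  have hc2 : D (i + 1, j) ≠ none :=
    h.convex (i, j) (i + 1, j) (i + 1, j + 1) (by simp) (by simp) (by simp [hd]) (by simp [hl])
  obtain ⟨x, hx⟩ := Option.ne_none_iff_exists'.1 hc2
  have e1 := h.lt_succ_row hd hx
  have e2 := h.lt_succ_col hx hl
  obtain x | ⟨⟩ := x
  · simp at e1 e2
    obtain rfl : x = k := by omega
    refine ⟨i, ?_, ?_, ?_, ?_⟩
    · rw [h.swap_of_dot hd, if_pos (Or.inl hx)]
    · rw [h.swap_of_inl hx, if_pos (Or.inl ⟨i, rfl, hd⟩)]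
    · rw [h.swap_of_inl hr, if_pos (Or.inr ⟨j, rfl, hd⟩)]
    · rw [swapVal_eq_inl_iff (by omega)]; exact hl
  · simp at e1

theorem IsStage.finite_dotCol (h : IsStage k D) (j : ℕ) : (dotCol D j).Finite := by
  refine (h.fin.image fun p => ((D p).bind (Sum.elim some fun _ => none)).getD 0).subset ?_
  rintro v ⟨i, hi⟩
  exact ⟨(i, j), by simp [shapeOf, hi], by simp [hi]⟩

/-- The factor of the stage word at the boundary of the columns `j` and `j + 1`. -/
def boundaryFactor {M : Type} [Monoid M] (g : ℤ → M) (k : ℤ) (D : ℕ × ℕ → Option ZDot) (j : ℕ) :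
    M :=
  if HasDotSquare (k - 1) D j then
    g (k - 1) * descProd g (dotCol D (j + 1) ∩ Set.Ici k) * descProd g (dotCol D j ∩ Set.Iio k)
  else descProd g (dotCol D j ∩ Set.Iio k) * descProd g (dotCol D (j + 1) ∩ Set.Ici k)

/-- The Hecke word attached to a dotted tableau in the middle of a slide. -/
def stageWord {M : Type} [Monoid M] (g : ℤ → M) (k : ℤ) (D : ℕ × ℕ → Option ZDot) (N : ℕ) : M :=
  descProd g (dotCol D 0 ∩ Set.Ici k) * ((List.range N).map (boundaryFactor g k D)).prod

theorem IsStage.stageWord_swap {M : Type} [Monoid M] {g : ℤ → M} (hg : HeckeRel g)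
    (h : IsStage k D) {N : ℕ} (hN : dotCol D N = ∅) :
    stageWord g (k + 1) (swapVal (Sum.inl k) (Sum.inr ()) D) N = stageWord g k D N := by
  set D' := swapVal (Sum.inl k) (Sum.inr ()) D with hD'
  have h' : IsStage (k + 1) D' := h.swap
  have hH : ∀ j, dotCol D' j ∩ Set.Ioi k = dotCol D j ∩ Set.Ioi k := by
    intro j; ext w
    simp only [Set.mem_inter_iff, Set.mem_Ioi, and_congr_left_iff]
    intro hw
    exact mem_dotCol_swap_of_ne (by omega) j
  have hL : ∀ j, dotCol D' j ∩ Set.Iio k = dotCol D j ∩ Set.Iio k := by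
    intro j; ext w
    simp only [Set.mem_inter_iff, Set.mem_Iio, and_congr_left_iff]
    intro hw
    exact mem_dotCol_swap_of_ne (by omega) j
  set y : ℕ → M := fun j => descProd g (dotCol D (j + 1) ∩ Set.Ioi k) *
    (if MovesLeft k D j then g k else 1) * descProd g (dotCol D j ∩ Set.Iio k) with hy
  set v : ℕ → M := fun j => if StaysInCol k D j then g k else 1 with hv
  have before : ∀ j, boundaryFactor g k D j = y j * v (j + 1) := by
    intro j
    rw [boundaryFactor, descProd_inter_Ici (h.finite_dotCol _)]
    refine boundary_before hg ((h.finite_dotCol _).inter_of_left _) (fun w hw => hw.2)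
      (fun w hw => hw.2) (mem_dotCol_succ_iff j) ?_ ?_
    · intro hs
      obtain ⟨a, b, c⟩ := hs.before
      exact ⟨a, b, c, sub_one_lt k⟩
    · intro hs he hk
      exact hs (h.hasDotSquare_before he hk.1)
  have after : ∀ j, boundaryFactor g (k + 1) D' j = v j * y j := by
    intro j
    have e : dotCol D' (j + 1) ∩ Set.Ici (k + 1) = dotCol D (j + 1) ∩ Set.Ioi k := by
      rw [← hH]; ext w; simp
    rw [boundaryFactor, add_sub_cancel_right, e, descProd_inter_Iio_add_one (h'.finite_dotCol _), hL]
    refine (boundary_after hg (fun w hw => hw.2) (fun w hw => hw.2) (h.mem_dotCol_swap_iff j)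
      h.hasDotSquare_after ?_).symm
    intro hs he hk
    exact hs (h.hasDotSquare_swap he hk.1)
  have hvN : v N = 1 := by
    have : ¬ StaysInCol k D N := by
      rintro ⟨i, hi, -⟩
      have : k ∈ dotCol D N := ⟨i, hi⟩
      simp [hN] at this
    simp [hv, this]
  have e0 : dotCol D' 0 ∩ Set.Ici (k + 1) = dotCol D 0 ∩ Set.Ioi k := by
    rw [← hH]; ext w; simp
  have := mul_prod_range_shift v y N
  rw [stageWord, stageWord, funext before, funext after, e0, descProd_inter_Ici (h.finite_dotCol _),
    mem_dotCol_zero_iff, mul_assoc]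
  change _ = _ * (v 0 * _)
  rw [this, hvN, mul_one]

end dotted


section slide

/-- The entries in a column of a tableau. -/
def tabCol (T : ℕ × ℕ → Option ℤ) (j : ℕ) : Set ℤ := {v | ∃ i, T (i, j) = some v}

/-- The Hecke word of the first `N` columns, read from left to right, each from bottom to top. -/
def colWord {M : Type} [Monoid M] (g : ℤ → M) (N : ℕ) (T : ℕ × ℕ → Option ℤ) : M :=
  ((List.range N).map fun j => descProd g (tabCol T j)).prod

theorem restrictInt_eq_some_iff {D : ℕ × ℕ → Option ZDot} {p : ℕ × ℕ} {v : ℤ} :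
    restrictInt D p = some v ↔ D p = some (Sum.inl v) := by
  rcases h : D p with _ | (x | ⟨⟩) <;> simp [restrictInt, h]

theorem tabCol_restrictInt (D : ℕ × ℕ → Option ZDot) (j : ℕ) :
    tabCol (restrictInt D) j = dotCol D j := by
  ext v
  simp [tabCol, dotCol, restrictInt_eq_some_iff]

theorem exists_of_swapUp_eq_inl {a : ℤ} {n : ℕ} {D : ℕ × ℕ → Option ZDot} {p : ℕ × ℕ} {x : ℤ}
    (h : swapUp a n D p = some (Sum.inl x)) : ∃ q, D q = some (Sum.inl x) := by
  induction n generalizing p with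
  | zero => exact ⟨p, h⟩
  | succ n ih =>
    simp only [swapUp, swapVal] at h
    split_ifs at h with h1 h2
    · simp at h
    · obtain ⟨β, -, hb⟩ := h2.2
      rw [h] at hb
      exact ih hb
    · exact ih h

theorem shapeOf_swapUp (a : ℤ) (n : ℕ) (D : ℕ × ℕ → Option ZDot) :
    shapeOf (swapUp a n D) = shapeOf D := by
  induction n with
  | zero => rfl
  | succ n ih => rw [swapUp, shapeOf_swapVal, ih]

theorem IsStage.swapUp {a : ℤ} {D : ℕ × ℕ → Option ZDot} (h : IsStage a D) (n : ℕ) :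
    IsStage (a + n) (swapUp a n D) := by
  induction n with
  | zero => simpa [_root_.swapUp] using h
  | succ n ih =>
    have := ih.swap
    rw [add_assoc] at this
    exact_mod_cast this

theorem dotCol_eq_empty {D : ℕ × ℕ → Option ZDot} {N : ℕ} (h : ∀ p ∈ shapeOf D, p.2 < N) :
    dotCol D N = ∅ := by
  ext v
  simp only [Set.mem_empty_iff_false, iff_false]
  rintro ⟨i, hi⟩
  exact lt_irrefl N (h (i, N) (by simp [shapeOf, hi]))

theorem IsStage.stageWord_swapUp {M : Type} [Monoid M] {g : ℤ → M} (hg : HeckeRel g) {a : ℤ}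
    {D : ℕ × ℕ → Option ZDot} (h : IsStage a D) {N : ℕ} (hN : ∀ p ∈ shapeOf D, p.2 < N) (n : ℕ) :
    stageWord g (a + n) (_root_.swapUp a n D) N = stageWord g a D N := by
  induction n with
  | zero => simp [_root_.swapUp]
  | succ n ih =>
    have := (h.swapUp n).stageWord_swap hg (N := N)
      (dotCol_eq_empty (by rwa [shapeOf_swapUp]))
    rw [ih, add_assoc] at this
    exact_mod_cast this

theorem stageWord_of_lt {M : Type} [Monoid M] (g : ℤ → M) {k : ℤ} {D : ℕ × ℕ → Option ZDot}
    (h : ∀ j, ∀ v ∈ dotCol D j, v < k) (N : ℕ) :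
    stageWord g k D N = colWord g N (restrictInt D) := by
  have h1 : ∀ j, dotCol D j ∩ Set.Ici k = ∅ := by
    intro j; ext v
    simp only [Set.mem_inter_iff, Set.mem_Ici, Set.mem_empty_iff_false, iff_false, not_and, not_le]
    exact h j v
  have h2 : ∀ j, dotCol D j ∩ Set.Iio k = dotCol D j := by
    intro j
    exact Set.inter_eq_left.2 fun v hv => h j v hv
  have h3 : boundaryFactor g k D = fun j => descProd g (dotCol D j) := by
    funext j
    rw [boundaryFactor, if_neg, h1, h2, descProd_empty, mul_one]
    rintro ⟨i, -, -, -, h4⟩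
    have := h _ _ ⟨_, h4⟩
    omega
  simp only [stageWord, h1, h3, descProd_empty, one_mul, colWord, tabCol_restrictInt]

theorem stageWord_of_ge {M : Type} [Monoid M] (g : ℤ → M) {k : ℤ} {D : ℕ × ℕ → Option ZDot}
    (h : ∀ j, ∀ v ∈ dotCol D j, k ≤ v) {N : ℕ} (hN : dotCol D N = ∅) :
    stageWord g k D N = colWord g N (restrictInt D) := by
  have h1 : ∀ j, dotCol D j ∩ Set.Iio k = ∅ := by
    intro j; ext v
    simp only [Set.mem_inter_iff, Set.mem_Iio, Set.mem_empty_iff_false, iff_false, not_and, not_lt]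
    exact h j v
  have h2 : ∀ j, dotCol D j ∩ Set.Ici k = dotCol D j := by
    intro j
    exact Set.inter_eq_left.2 fun v hv => h j v hv
  have h3 : boundaryFactor g k D = fun j => descProd g (dotCol D (j + 1)) := by
    funext j
    rw [boundaryFactor, if_neg, h1, h2, descProd_empty, one_mul]
    rintro ⟨i, h4, -, -, -⟩
    have := h _ _ ⟨_, h4⟩
    omega
  have h4 := List.prod_range_succ (fun j => descProd g (dotCol D j)) N
  rw [List.prod_range_succ', hN, descProd_empty, mul_one] at h4
  simp only [stageWord, h2, h3, colWord, tabCol_restrictInt, h4]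

theorem restrictInt_addDots {T : ℕ × ℕ → Option ℤ} {C : Finset (ℕ × ℕ)}
    (h : ∀ c ∈ C, T c = none) : restrictInt (addDots C (toDotted T)) = T := by
  funext p
  by_cases hp : p ∈ C
  · simp [restrictInt, addDots, hp, h p hp]
  · rcases hT : T p with _ | x <;> simp [restrictInt, addDots, hp, toDotted, hT]

variable {T : ℕ × ℕ → Option ℤ} {lam nu C : Finset (ℕ × ℕ)} {a b : ℤ}

theorem mem_shape_iff (hs : shapeOf T = (nu : Set (ℕ × ℕ)) \ lam) (p : ℕ × ℕ) :
    T p ≠ none ↔ p ∈ nu ∧ p ∉ lam := by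
  have : p ∈ shapeOf T ↔ p ∈ (nu : Set (ℕ × ℕ)) \ lam := by rw [hs]
  simpa [shapeOf] using this

theorem addDots_ne_none_iff (hs : shapeOf T = (nu : Set (ℕ × ℕ)) \ lam) (p : ℕ × ℕ) :
    addDots C (toDotted T) p ≠ none ↔ p ∈ C ∨ p ∈ nu ∧ p ∉ lam := by
  rw [← mem_shape_iff hs]
  by_cases hp : p ∈ C <;> simp [addDots, hp, toDotted]

theorem addDots_eq_inl_iff {p : ℕ × ℕ} {x : ℤ} :
    addDots C (toDotted T) p = some (Sum.inl x) ↔ p ∉ C ∧ T p = some x := by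
  by_cases hp : p ∈ C <;> simp [addDots, hp, toDotted]

theorem addDots_eq_inr_iff {p : ℕ × ℕ} {u : Unit} :
    addDots C (toDotted T) p = some (Sum.inr u) ↔ p ∈ C := by
  by_cases hp : p ∈ C <;> simp [addDots, hp, toDotted]

theorem isStage_addDots (hT : Increasing T) (hp : IsSkewPair lam nu)
    (hs : shapeOf T = (nu : Set (ℕ × ℕ)) \ lam) (hv : ValuesIn T a b)
    (hC : ∀ c ∈ C, c ∈ lam ∧ ∀ d ∈ lam, ¬ c < d) : IsStage a (addDots C (toDotted T)) where
  fin := by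
    refine (nu.finite_toSet).subset fun p h => ?_
    rcases (addDots_ne_none_iff hs p).1 h with h | h
    · exact hp.2.2 (hC p h).1
    · exact h.1
  convex x y z hxy hyz hx hz := by
    rw [addDots_ne_none_iff hs] at *
    have hz' : z ∈ nu := by
      rcases hz with h | h
      · exact hp.2.2 (hC z h).1
      · exact h.1
    have hy : y ∈ nu := hp.2.1 z hz' y hyz
    by_cases hyl : y ∈ lam
    · left
      have hxl : x ∈ lam := hp.1 y hyl x hxy
      have hxC : x ∈ C := by
        rcases hx with h | h
        · exact h
        · exact absurd hxl h.2
      rcases hxy.eq_or_lt with rfl | h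
      · exact hxC
      · exact absurd h ((hC x hxC).2 y hyl)
    · exact Or.inr ⟨hy, hyl⟩
  mono := by
    rintro p q hlt (x | ⟨⟩) (y | ⟨⟩) hx hy
    · rw [addDots_eq_inl_iff] at hx hy
      have := hT _ _ hlt _ _ hx.2 hy.2
      simp only [dotRank_inl]; omega
    · rw [addDots_eq_inl_iff] at hx
      rw [addDots_eq_inr_iff] at hy
      have h1 := (mem_shape_iff hs p).1 (by simp [hx.2])
      exact absurd (hp.1 q (hC q hy).1 p hlt.le) h1.2
    · rw [addDots_eq_inl_iff] at hy
      have := (hv _ _ hy.2).1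
      simp only [dotRank_inl, dotRank_inr]; omega
    · rw [addDots_eq_inr_iff] at hx hy
      exact absurd hlt ((hC p hx).2 q (hC q hy).1)

theorem straightShape_sdiff (hl : StraightShape lam)
    (hC : ∀ c ∈ C, c ∈ lam ∧ ∀ d ∈ lam, ¬ c < d) : StraightShape (lam \ C) := by
  intro x hx y hyx
  rw [Finset.mem_sdiff] at *
  refine ⟨hl x hx.1 y hyx, fun hy => ?_⟩
  rcases hyx.eq_or_lt with rfl | h
  · exact hx.2 hy
  · exact (hC y hy).2 x hx.1 h

/-- A forward slide of an increasing tableau is an increasing tableau on a skew shape with the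
given boxes removed from the inner shape, with the same Hecke word. -/
theorem forwardSlide_spec (hT : Increasing T) (hp : IsSkewPair lam nu)
    (hs : shapeOf T = (nu : Set (ℕ × ℕ)) \ lam) (hv : ValuesIn T a b)
    (hC : ∀ c ∈ C, c ∈ lam ∧ ∀ d ∈ lam, ¬ c < d) {T' : ℕ × ℕ → Option ℤ}
    (hT' : T' = restrictInt (swapUp a (b - a + 1).toNat (addDots C (toDotted T)))) :
    Increasing T' ∧
    (∃ nu' : Finset (ℕ × ℕ), IsSkewPair (lam \ C) nu' ∧
      shapeOf T' = (nu' : Set (ℕ × ℕ)) \ (lam \ C : Finset (ℕ × ℕ))) ∧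
    (∀ p v, T' p = some v → ∃ q, T q = some v) ∧
    ∀ {M : Type} [Monoid M] {g : ℤ → M}, HeckeRel g → ∀ N, (∀ p ∈ nu, p.2 < N) →
      colWord g N T' = colWord g N T := by
  set n := (b - a + 1).toNat
  set D₀ := addDots C (toDotted T) with hD₀
  set D := swapUp a n D₀ with hD
  have st₀ : IsStage a D₀ := isStage_addDots hT hp hs hv hC
  have st : IsStage (a + n) D := st₀.swapUp n
  have hval : ∀ p v, D p = some (Sum.inl v) → ∃ q, T q = some v := by
    intro p v h
    obtain ⟨q, hq⟩ := exists_of_swapUp_eq_inl h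
    exact ⟨q, (addDots_eq_inl_iff.1 hq).2⟩
  have hlt : ∀ p v, D p = some (Sum.inl v) → v < a + n := by
    intro p v h
    obtain ⟨q, hq⟩ := hval p v h
    have := hv q v hq
    omega
  have hshape : ∀ p, D p ≠ none ↔ p ∈ C ∨ p ∈ nu ∧ p ∉ lam := by
    intro p
    rw [← addDots_ne_none_iff hs]
    have : p ∈ shapeOf D ↔ p ∈ shapeOf D₀ := by rw [hD, shapeOf_swapUp]
    exact this
  have hshape_nu : ∀ p ∈ shapeOf D, p ∈ nu := by
    intro p h
    rcases (hshape p).1 h with h | h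
    · exact hp.2.2 (hC p h).1
    · exact h.1
  refine ⟨?_, ⟨nu.filter fun p => p ∈ lam \ C ∨ T' p ≠ none, ⟨?_, ?_, ?_⟩, ?_⟩, ?_, ?_⟩
  · intro p q hpq x y hx hy
    rw [hT', restrictInt_eq_some_iff] at hx hy
    have := st.mono _ _ hpq _ _ hx hy
    simpa using this
  · exact straightShape_sdiff hp.1 hC
  · intro p hpn q hqp
    rw [Finset.mem_filter] at hpn ⊢
    refine ⟨hp.2.1 p hpn.1 q hqp, ?_⟩
    rcases hpn.2 with h | h
    · exact Or.inl (straightShape_sdiff hp.1 hC p h q hqp)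
    · by_cases hq : q ∈ lam \ C
      · exact Or.inl hq
      · right
        have hDq : D q ≠ none := by
          rw [hshape]
          rw [Finset.mem_sdiff] at hq
          have := hp.2.1 p hpn.1 q hqp
          tauto
        obtain ⟨y, hy⟩ := Option.ne_none_iff_exists'.1 h
        rw [hT', restrictInt_eq_some_iff] at hy
        obtain ⟨x, hx⟩ := Option.ne_none_iff_exists'.1 hDq
        obtain x | ⟨⟩ := x
        · rw [hT', restrictInt_eq_some_iff.2 hx]; simp
        · have hne : q ≠ p := by rintro rfl; rw [hy] at hx; simp at hx
          have h1 := st.mono q p (lt_of_le_of_ne hqp hne) _ _ hx hy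
          have h2 := hlt _ _ hy
          simp only [dotRank_inl, dotRank_inr] at h1
          omega
  · intro p hpl
    rw [Finset.mem_filter]
    exact ⟨hp.2.2 (Finset.mem_sdiff.1 hpl).1, Or.inl hpl⟩
  · ext p
    simp only [Set.mem_sdiff, Finset.mem_coe, Finset.mem_filter]
    constructor
    · intro h
      obtain ⟨y, hy⟩ := Option.ne_none_iff_exists'.1 h
      rw [hT', restrictInt_eq_some_iff] at hy
      have hDp : D p ≠ none := by simp [hy]
      refine ⟨⟨hshape_nu p hDp, Or.inr h⟩, ?_⟩
      rw [Finset.mem_sdiff]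
      have := (hshape p).1 hDp
      tauto
    · rintro ⟨⟨-, h | h⟩, h'⟩
      · exact absurd h h'
      · exact h
  · intro p v h
    rw [hT', restrictInt_eq_some_iff] at h
    exact hval p v h
  · intro M _ g hg N hN
    have hN' : ∀ p ∈ shapeOf D₀, p.2 < N := by
      intro p h
      refine hN p (hshape_nu p ?_)
      rwa [hD, shapeOf_swapUp]
    have hTC : ∀ c ∈ C, T c = none := by
      intro c hc
      by_contra h
      exact ((mem_shape_iff hs c).1 h).2 (hC c hc).1
    rw [hT', ← stageWord_of_lt g (k := a + n), st₀.stageWord_swapUp hg hN' n, stageWord_of_ge g,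
      restrictInt_addDots hTC]
    · rintro j v ⟨i, hi⟩
      exact (hv _ _ (addDots_eq_inl_iff.1 hi).2).1
    · exact dotCol_eq_empty hN'
    · rintro j v ⟨i, hi⟩
      exact hlt _ _ hi

theorem forwardSlides_spec {T U : ℕ × ℕ → Option ℤ} (h : Relation.ReflTransGen IsForwardSlide T U)
    (hT : Increasing T) :
    Increasing U ∧ (∀ p v, U p = some v → ∃ q, T q = some v) ∧
    ∀ {M : Type} [Monoid M] {g : ℤ → M}, HeckeRel g → ∀ᶠ N in Filter.atTop,
      colWord g N U = colWord g N T := by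
  induction h with
  | refl => exact ⟨hT, fun p v h => ⟨p, h⟩, fun _ => Filter.Eventually.of_forall fun _ => rfl⟩
  | tail _ hs ih =>
    obtain ⟨h1, h2, h3⟩ := ih
    obtain ⟨lam, nu, C, a, b, hp, hsh, hv, hC, hT'⟩ := hs
    obtain ⟨k1, -, k2, k3⟩ := forwardSlide_spec h1 hp hsh hv hC hT'
    refine ⟨k1, fun p v h => ?_, fun hg => ?_⟩
    · obtain ⟨q, hq⟩ := k2 p v h
      exact h2 q v hq
    · filter_upwards [h3 hg, Filter.eventually_gt_atTop (nu.sup Prod.snd)] with N e1 e2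
      rw [← e1]
      exact k3 hg N fun p hp => (Finset.le_sup (f := Prod.snd) hp).trans_lt e2

theorem exists_valuesIn (hs : shapeOf T = (nu : Set (ℕ × ℕ)) \ lam) : ∃ a b, ValuesIn T a b := by
  have hfin : {x | ∃ p, T p = some x}.Finite := by
    refine (nu.finite_toSet.image fun p => (T p).getD 0).subset ?_
    rintro x ⟨p, hp⟩
    exact ⟨p, ((mem_shape_iff hs p).1 (by simp [hp])).1, by simp [hp]⟩
  obtain ⟨a, ha⟩ := hfin.bddBelow
  obtain ⟨b, hb⟩ := hfin.bddAbove
  exact ⟨a, b, fun p x h => ⟨ha ⟨p, h⟩, hb ⟨p, h⟩⟩⟩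

theorem exists_rectification (hT : Increasing T) (hp : IsSkewPair lam nu)
    (hs : shapeOf T = (nu : Set (ℕ × ℕ)) \ lam) : ∃ U, RectifiesTo T U := by
  induction hn : lam.card using Nat.strong_induction_on generalizing lam nu T with
  | _ n ih =>
    rcases lam.eq_empty_or_nonempty with rfl | hne
    · exact ⟨T, Relation.ReflTransGen.refl, nu, hp.2.1, by simpa using hs⟩
    · obtain ⟨c, hc⟩ := lam.exists_maximal hne
      obtain ⟨a, b, hv⟩ := exists_valuesIn hs
      have hC : ∀ c' ∈ ({c} : Finset (ℕ × ℕ)), c' ∈ lam ∧ ∀ d ∈ lam, ¬ c' < d := by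
        intro c' h
        rw [Finset.mem_singleton] at h
        subst h
        exact ⟨hc.1, fun d hd hlt => hc.not_gt hd hlt⟩
      obtain ⟨k1, ⟨nu', k2, k3⟩, -⟩ := forwardSlide_spec hT hp hs hv hC rfl
      have hcard : (lam \ {c}).card < n := by
        rw [← hn]
        refine Finset.card_lt_card ⟨Finset.sdiff_subset, fun h => ?_⟩
        have := h hc.1
        simp at this
      obtain ⟨U, hU1, hU2⟩ := ih _ hcard k1 k2 k3 rfl
      exact ⟨U, hU1.head ⟨lam, nu, {c}, a, b, hp, hs, hv, hC, rfl⟩, hU2⟩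

end slide


section bubble

/-- Sort the values at the positions `k` and `k + 1` into decreasing order. -/
def bubble (k : ℤ) (f : ℤ → ℤ) : ℤ → ℤ := fun p =>
  if p = k then max (f k) (f (k + 1)) else if p = k + 1 then min (f k) (f (k + 1)) else f p

/-- The operators `bubble k`, acting from the right. -/
def bubbleOp (k : ℤ) : (Function.End (ℤ → ℤ))ᵐᵒᵖ := MulOpposite.op (bubble k)

theorem bubbleOp_heckeRel : HeckeRel bubbleOp where
  idem i := by
    refine MulOpposite.unop_injective (funext fun f => funext fun p => ?_)
    change bubble i (bubble i f) p = bubble i f p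
    simp only [bubble]
    split_ifs <;> omega
  comm i j h := by
    refine MulOpposite.unop_injective (funext fun f => funext fun p => ?_)
    change bubble j (bubble i f) p = bubble i (bubble j f) p
    have h1 : i ≠ j := by omega
    have h2 : i ≠ j + 1 := by omega
    have h3 : i + 1 ≠ j := by omega
    simp only [bubble, h1, h2, h3, h1.symm, h2.symm, h3.symm, add_left_inj, if_false]
    split_ifs <;> simp_all
  braid i := by
    refine MulOpposite.unop_injective (funext fun f => funext fun p => ?_)
    change bubble i (bubble (i + 1) (bubble i f)) p =
      bubble (i + 1) (bubble i (bubble (i + 1) f)) p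
    have h1 : i + 1 + 1 ≠ i := by omega
    simp only [bubble, h1, h1.symm, add_eq_left, left_eq_add, one_ne_zero, if_true,
      if_false]
    split_ifs <;> omega

/-- The action of the decreasing product over a set of positions. -/
def bubbleSet (S : Set ℤ) (f : ℤ → ℤ) : ℤ → ℤ := (descProd bubbleOp S).unop f

theorem bubbleSet_empty (f : ℤ → ℤ) : bubbleSet ∅ f = f := by
  rw [bubbleSet, descProd_empty]
  rfl

theorem bubbleSet_inter_Ici {S : Set ℤ} (hS : S.Finite) (t : ℤ) (f : ℤ → ℤ) :
    bubbleSet (S ∩ Set.Ici t) f = if t ∈ S then bubble t (bubbleSet (S ∩ Set.Ici (t + 1)) f)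
      else bubbleSet (S ∩ Set.Ici (t + 1)) f := by
  have e : S ∩ Set.Ici (t + 1) = S ∩ Set.Ioi t := by ext w; simp
  rw [bubbleSet, descProd_inter_Ici hS, e]
  split_ifs <;> rfl

/-- Descending induction on the lower end of the part of a finite set of integers acting. -/
theorem descending_induction {S : Set ℤ} (hS : S.Finite) {P : ℤ → Prop}
    (h0 : ∀ t, S ∩ Set.Ici t = ∅ → P t) (h1 : ∀ t, P (t + 1) → P t) (t : ℤ) : P t := by
  obtain ⟨b, hb⟩ := hS.bddAbove
  have hbig : ∀ s, b < s → P s := by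
    intro s hs
    refine h0 s ?_
    ext v
    simp only [Set.mem_inter_iff, Set.mem_Ici, Set.mem_empty_iff_false, iff_false, not_and, not_le]
    intro hv
    exact (hb hv).trans_lt hs
  have key : ∀ n : ℕ, ∀ s, b < s + n → P s := by
    intro n
    induction n with
    | zero => intro s hs; exact hbig s (by simpa using hs)
    | succ n ih => intro s hs; exact h1 s (ih _ (by push_cast at hs; omega))
  exact key (b + 1 - t).toNat t (by omega)

theorem exists_inter_Ici_eq {S : Set ℤ} (hS : S.Finite) : ∃ t, S ∩ Set.Ici t = S := by
  obtain ⟨b, hb⟩ := hS.bddBelow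
  exact ⟨b, Set.inter_eq_left.2 fun v hv => hb hv⟩

theorem bubbleSet_induction {S : Set ℤ} (hS : S.Finite) {P : (ℤ → ℤ) → Prop} {f : ℤ → ℤ}
    (h0 : P f) (h1 : ∀ t ∈ S, ∀ f', P f' → P (bubble t f')) : P (bubbleSet S f) := by
  obtain ⟨t, ht⟩ := exists_inter_Ici_eq hS
  rw [← ht]
  refine descending_induction hS (P := fun t => P (bubbleSet (S ∩ Set.Ici t) f)) ?_ ?_ t
  · intro s hs
    rw [hs, bubbleSet_empty]
    exact h0
  · intro s hs
    rw [bubbleSet_inter_Ici hS]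
    split_ifs with h
    · exact h1 s h _ hs
    · exact hs

theorem bubbleSet_of_notMem {S : Set ℤ} (hS : S.Finite) {p : ℤ} (h : p ∉ S) (h' : p - 1 ∉ S)
    (f : ℤ → ℤ) : bubbleSet S f p = f p := by
  refine bubbleSet_induction hS (P := fun f' => f' p = f p) rfl ?_
  intro t ht f' hf'
  have h1 : p ≠ t := by rintro rfl; exact h ht
  have h2 : p ≠ t + 1 := by rintro rfl; exact h' (by simpa using ht)
  simp [bubble, h1, h2, hf']

theorem bubble_injective {f : ℤ → ℤ} (hf : Function.Injective f) (k : ℤ) :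
    Function.Injective (bubble k f) := by
  intro p q h
  have key : ∀ x y, f x = f y → x = y := fun x y h => hf h
  have h1 := key p q
  have h2 := key k q
  have h3 := key (k + 1) q
  have h4 := key p k
  have h5 := key p (k + 1)
  have h6 := key k (k + 1)
  simp only [bubble] at h
  split_ifs at h <;> omega

theorem bubbleSet_injective {S : Set ℤ} (hS : S.Finite) {f : ℤ → ℤ} (hf : Function.Injective f) :
    Function.Injective (bubbleSet S f) :=
  bubbleSet_induction hS (P := Function.Injective) hf fun t _ _ h => bubble_injective h t

theorem bubbleSet_split {S : Set ℤ} (hS : S.Finite) (t : ℤ) (f : ℤ → ℤ) :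
    bubbleSet S f = bubbleSet (S ∩ Set.Iio t) (bubbleSet (S ∩ Set.Ici t) f) := by
  rw [bubbleSet, descProd_split hS t, ← descProd_inter_Ici hS]
  rfl

theorem bubbleSet_apply_of_ge {S : Set ℤ} (hS : S.Finite) {t p : ℤ} (ht : t - 1 ∉ S) (hp : t ≤ p)
    (f : ℤ → ℤ) : bubbleSet S f p = bubbleSet (S ∩ Set.Ici t) f p := by
  rw [bubbleSet_split hS t]
  refine bubbleSet_of_notMem (hS.inter_of_left _) ?_ ?_ _
  · rintro ⟨-, h⟩
    exact absurd h (by simpa using hp)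
  · rintro ⟨h, h'⟩
    obtain rfl : p = t := by simp at h'; omega
    exact ht h

theorem bubbleSet_inter_Ici_of_lt {S : Set ℤ} (hS : S.Finite) {t p : ℤ} (hp : p < t)
    (f : ℤ → ℤ) : bubbleSet (S ∩ Set.Ici t) f p = f p := by
  refine bubbleSet_of_notMem (hS.inter_of_left _) ?_ ?_ _ <;> rintro ⟨-, h⟩ <;> simp at h <;> omega

/-- The maximum over an interval of acting positions ends up at its lower end. -/
theorem bubbleSet_lt_of_Icc_subset {R : Set ℤ} (hR : R.Finite) {f : ℤ → ℤ}
    (hf : Function.Injective f) {t m : ℤ} (ht : t - 1 ∉ R) (htm : t < m)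
    (hI : ∀ s, t ≤ s → s < m → s ∈ R) : bubbleSet R f m < bubbleSet R f t := by
  rw [bubbleSet_apply_of_ge hR ht le_rfl, bubbleSet_apply_of_ge hR ht htm.le]
  have key : ∀ n : ℕ, t ≤ m - 1 - n →
      bubbleSet (R ∩ Set.Ici (m - 1 - n)) f m <
        bubbleSet (R ∩ Set.Ici (m - 1 - n)) f (m - 1 - n) := by
    intro n
    induction n with
    | zero =>
      intro h
      have hinj := (bubbleSet_injective (hR.inter_of_left (Set.Ici (m - 1 + 1))) hf).ne
        (show m - 1 ≠ m - 1 + 1 by omega)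
      simp only [Nat.cast_zero, sub_zero] at h ⊢
      rw [bubbleSet_inter_Ici hR, if_pos (hI _ h (by omega))]
      simp only [bubble, if_true, sub_add_cancel] at hinj ⊢
      split_ifs <;> omega
    | succ n ih =>
      intro h
      push_cast at h ⊢
      have ih' := ih (by omega)
      have e : m - 1 - (n + 1 : ℤ) + 1 = m - 1 - n := by ring
      rw [bubbleSet_inter_Ici hR, if_pos (hI _ h (by omega)), e]
      simp only [bubble, e, if_true]
      rw [if_neg (by omega), if_neg (by omega)]
      omega
  have := key (m - 1 - t).toNat (by omega)
  rwa [show m - 1 - ((m - 1 - t).toNat : ℤ) = t by omega] at this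

/-- The sequence `f` contains no pattern `132` at positions at least `d`. -/
def Avoids132 (d : ℤ) (f : ℤ → ℤ) : Prop :=
  ∀ p q r, d ≤ p → p < q → q < r → f p < f r → f r < f q → False

/-- The condition on consecutive columns under which avoidance of `132` is preserved. -/
def ColumnStep (R S : Set ℤ) : Prop :=
  ∀ k ∈ S, 2 ≤ k → k - 1 ∉ S →
    k - 2 ∉ R ∧ ∀ m, (∀ s, k ≤ s → s ≤ m → s ∈ S) → ∀ s, k ≤ s → s ≤ m → s - 1 ∈ R

theorem Avoids132.bubbleSet {R S : Set ℤ} (hR : R.Finite) (hS : S.Finite) (hpos : ∀ v ∈ S, 1 ≤ v)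
    (hRS : ColumnStep R S) {f : ℤ → ℤ} (hf : Function.Injective f)
    (ha : Avoids132 1 (_root_.bubbleSet R f)) :
    Avoids132 1 (_root_.bubbleSet S (_root_.bubbleSet R f)) := by
  set a := _root_.bubbleSet R f with ha'
  have key : ∀ t, ∀ p q r, 1 ≤ p → p < q → q < r →
      _root_.bubbleSet (S ∩ Set.Ici t) a p < _root_.bubbleSet (S ∩ Set.Ici t) a r →
      _root_.bubbleSet (S ∩ Set.Ici t) a r < _root_.bubbleSet (S ∩ Set.Ici t) a q →
      q = t ∧ t ∈ S ∧ ∀ k, 2 ≤ k → k ≤ t → (∀ s, k ≤ s → s ≤ t → s ∈ S) → k - 1 ∉ S →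
        _root_.bubbleSet (S ∩ Set.Ici t) a r < a (k - 1) := by
    refine descending_induction hS ?_ ?_
    · intro t ht p q r h1 h2 h3 h4 h5
      rw [ht, bubbleSet_empty] at h4 h5
      exact (ha p q r h1 h2 h3 h4 h5).elim
    · intro t ih p q r h1 h2 h3 h4 h5
      have hlow : ∀ s, s < t + 1 → _root_.bubbleSet (S ∩ Set.Ici (t + 1)) a s = a s :=
        fun s hs => bubbleSet_inter_Ici_of_lt hS hs a
      rw [bubbleSet_inter_Ici hS] at h4 h5 ⊢
      generalize hb : _root_.bubbleSet (S ∩ Set.Ici (t + 1)) a = b at *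
      by_cases htS : t ∈ S
      · have ht1 := hpos t htS
        rw [if_pos htS] at h4 h5 ⊢
        by_cases hbt : b (t + 1) ≤ b t
        · have e : bubble t b = b := by
            funext s
            simp only [bubble]
            split_ifs with h h'
            · rw [h]; omega
            · rw [h']; omega
            · rfl
          rw [e] at h4 h5
          obtain ⟨rfl, -, -⟩ := ih p q r h1 h2 h3 h4 h5
          have hpt : p ≠ t := by rintro rfl; omega
          have := (ih p t r h1 (by omega) (by omega) h4 (by omega)).1
          omega
        · have e1 : bubble t b t = b (t + 1) := by simp [bubble]; omega
          have e2 : bubble t b (t + 1) = b t := by simp [bubble]; omega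
          have e3 : ∀ s, s ≠ t → s ≠ t + 1 → bubble t b s = b s := by
            intro s h h'; simp [bubble, h, h']
          have hq : q = t ∧ (t + 1 < r → t + 1 ∈ S ∧ ∀ k, 2 ≤ k → k ≤ t + 1 →
              (∀ s, k ≤ s → s ≤ t + 1 → s ∈ S) → k - 1 ∉ S → b r < a (k - 1)) := by
            by_cases hq : q = t
            · subst hq
              refine ⟨rfl, fun hr => ?_⟩
              rw [e3 p (by omega) (by omega), e3 r (by omega) (by omega)] at h4
              rw [e1, e3 r (by omega) (by omega)] at h5
              exact (ih p (q + 1) r h1 (by omega) hr h4 h5).2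
            · exfalso
              set σ : ℤ → ℤ := fun s => if s = t then t + 1 else if s = t + 1 then t else s with hσ
              have eσ : ∀ s, bubble t b s = b (σ s) := by
                intro s
                simp only [hσ]
                split_ifs with h h'
                · rw [h, e1]
                · rw [h', e2]
                · exact e3 s h h'
              have hpq : ¬ (p = t ∧ q = t + 1) := by
                rintro ⟨rfl, rfl⟩
                rw [e1] at h4
                rw [e2] at h5
                omega
              rw [eσ, eσ] at h4 h5
              have := (ih (σ p) (σ q) (σ r) (by grind) (by grind) (by grind) h4 h5).1
              grind
          obtain ⟨rfl, hq⟩ := hq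
          refine ⟨rfl, htS, fun k hk hkt hI hkS => ?_⟩
          by_cases hr : q + 1 < r
          · obtain ⟨h6, h7⟩ := hq hr
            rw [e3 r (by omega) (by omega)]
            refine h7 k hk (by omega) (fun s hs hs' => ?_) hkS
            by_cases hsq : s = q + 1
            · rw [hsq]; exact h6
            · exact hI s hs (by omega)
          · obtain rfl : r = q + 1 := by omega
            rw [e2, hlow q (by omega)]
            obtain ⟨h6, h7⟩ := hRS k (hI k le_rfl hkt) hk hkS
            refine bubbleSet_lt_of_Icc_subset hR hf (t := k - 1) (m := q) ?_ (by omega) ?_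
            · rwa [show k - 1 - 1 = k - 2 by ring]
            · intro s hs hs'
              have := h7 q hI (s + 1) (by omega) (by omega)
              simpa using this
      · rw [if_neg htS] at h4 h5
        exfalso
        obtain ⟨rfl, h6, h7⟩ := ih p q r h1 h2 h3 h4 h5
        have h8 := h7 (t + 1) (by omega) le_rfl
          (fun s hs hs' => by obtain rfl : s = t + 1 := by omega
                              exact h6) (by simpa using htS)
        rw [add_sub_cancel_right, ← hlow t (by omega)] at h8
        have hpt : p ≠ t := by rintro rfl; omega
        have := (ih p t r h1 (by omega) (by omega) h4 h8).1
        omega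
  intro p q r h1 h2 h3 h4 h5
  have e : S ∩ Set.Ici 1 = S := Set.inter_eq_left.2 fun v hv => hpos v hv
  have := (key 1 p q r h1 h2 h3 (by rwa [e]) (by rwa [e])).1
  omega

end bubble


section minimal

/-- A convex increasing tableau with positive entries in which each entry `k ≥ 2` has a lower
neighbor with entry `k - 1`. -/
structure IsMinimal (T : ℕ × ℕ → Option ℤ) : Prop where
  fin : ∀ j, (tabCol T j).Finite
  convex : ∀ a b c, a ≤ b → b ≤ c → T a ≠ none → T c ≠ none → T b ≠ none
  inc : Increasing T
  pos : ∀ p v, T p = some v → 1 ≤ v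
  pred : ∀ i j k, T (i, j) = some k → 2 ≤ k →
    (∃ i', i = i' + 1 ∧ T (i', j) = some (k - 1)) ∨ (∃ j', j = j' + 1 ∧ T (i, j') = some (k - 1))

variable {T : ℕ × ℕ → Option ℤ}

theorem IsMinimal.succ_row (h : IsMinimal T) {i j : ℕ} {k : ℤ} (hi : T (i, j) = some k)
    (hk : k + 1 ∈ tabCol T j) : T (i + 1, j) = some (k + 1) := by
  obtain ⟨i', hi'⟩ := hk
  have hlt : i < i' := by
    rcases lt_trichotomy i i' with h' | rfl | h'
    · exact h'
    · rw [hi] at hi'; simp at hi'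
    · have := h.inc (i', j) (i, j) (by simpa using h') _ _ hi' hi
      omega
  have hc : T (i + 1, j) ≠ none :=
    h.convex (i, j) (i + 1, j) (i', j) (by simp) (by simpa using hlt) (by simp [hi]) (by simp [hi'])
  obtain ⟨x, hx⟩ := Option.ne_none_iff_exists'.1 hc
  have e1 := h.inc (i, j) (i + 1, j) (by simp) _ _ hi hx
  by_cases e : i' = i + 1
  · rw [← e]; exact hi'
  · have e2 := h.inc (i + 1, j) (i', j) (by simp; omega) _ _ hx hi'
    omega

theorem IsMinimal.columnStep_zero (h : IsMinimal T) : ColumnStep ∅ (tabCol T 0) := by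
  rintro k ⟨i, hi⟩ hk hkS
  rcases h.pred i 0 k hi hk with ⟨i', -, h'⟩ | ⟨j', h', -⟩
  · exact absurd ⟨i', h'⟩ hkS
  · omega

theorem IsMinimal.columnStep_succ (h : IsMinimal T) (j : ℕ) :
    ColumnStep (tabCol T j) (tabCol T (j + 1)) := by
  rintro k ⟨i, hi⟩ hk hkS
  have hl : T (i, j) = some (k - 1) := by
    rcases h.pred i (j + 1) k hi hk with ⟨i', -, h'⟩ | ⟨j', hj, h'⟩
    · exact absurd ⟨i', h'⟩ hkS
    · obtain rfl : j = j' := by omega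
      exact h'
  refine ⟨?_, ?_⟩
  · rintro ⟨i', hi'⟩
    have hlt : i' < i := by
      rcases lt_trichotomy i i' with h' | rfl | h'
      · have := h.inc (i, j) (i', j) (by simpa using h') _ _ hl hi'
        omega
      · rw [hl] at hi'; simp at hi'
      · exact h'
    have hi1 : T (i' + 1, j) = some (k - 1) := by
      have := h.succ_row hi' (show k - 2 + 1 ∈ tabCol T j from ⟨i, by rw [hl]; congr 1; ring⟩)
      rw [this]; congr 1; ring
    obtain rfl : i = i' + 1 := by
      by_contra hne
      have := h.inc (i' + 1, j) (i, j) (by simp; omega) _ _ hi1 hl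
      omega
    have hc : T (i', j + 1) ≠ none :=
      h.convex (i', j) (i', j + 1) (i' + 1, j + 1) (by simp) (by simp) (by simp [hi'])
        (by simp [hi])
    obtain ⟨x, hx⟩ := Option.ne_none_iff_exists'.1 hc
    have e1 := h.inc (i', j) (i', j + 1) (by simp) _ _ hi' hx
    have e2 := h.inc (i', j + 1) (i' + 1, j + 1) (by simp) _ _ hx hi
    exact hkS ⟨i', by rw [hx]; congr 1; omega⟩
  · intro m hI
    have key : ∀ n : ℕ, k + n ≤ m →
        T (i + n, j + 1) = some (k + n) ∧ T (i + n, j) = some (k + n - 1) := by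
      intro n
      induction n with
      | zero => intro _; simpa using ⟨hi, hl⟩
      | succ n ih =>
        intro hm
        push_cast at hm
        obtain ⟨h1, h2⟩ := ih (by omega)
        have h3 := h.succ_row h1 (hI _ (by omega) (by omega))
        have hc : T (i + n + 1, j) ≠ none :=
          h.convex (i + n, j) (i + n + 1, j) (i + n + 1, j + 1) (by simp) (by simp) (by simp [h2])
            (by simp [h3])
        obtain ⟨x, hx⟩ := Option.ne_none_iff_exists'.1 hc
        have e1 := h.inc (i + n, j) (i + n + 1, j) (by simp) _ _ h2 hx
        have e2 := h.inc (i + n + 1, j) (i + n + 1, j + 1) (by simp) _ _ hx h3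
        push_cast
        rw [← add_assoc i n 1, h3, hx]
        exact ⟨by congr 1; ring, by congr 1; omega⟩
    intro s hs hsm
    refine ⟨i + (s - k).toNat, ?_⟩
    rw [(key (s - k).toNat (by omega)).2]
    congr 1; omega

/-- The result of acting on `f` by the word of the first `N` columns of a tableau. -/
def colState (N : ℕ) (T : ℕ × ℕ → Option ℤ) (f : ℤ → ℤ) : ℤ → ℤ :=
  (colWord bubbleOp N T).unop f

theorem colState_succ (N : ℕ) (T : ℕ × ℕ → Option ℤ) (f : ℤ → ℤ) :
    colState (N + 1) T f = bubbleSet (tabCol T N) (colState N T f) := by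
  rw [colState, colWord, List.prod_range_succ]
  rfl

theorem colState_succ' (N : ℕ) (T : ℕ × ℕ → Option ℤ) (f : ℤ → ℤ) :
    colState (N + 1) T f =
      colState N (fun p => T (p.1, p.2 + 1)) (bubbleSet (tabCol T 0) f) := by
  rw [colState, colWord, List.prod_range_succ']
  rfl

theorem IsMinimal.avoids132 (h : IsMinimal T) (N : ℕ) : Avoids132 1 (colState N T id) := by
  have key : Function.Injective (colState N T id) ∧ Avoids132 1 (colState N T id) ∧
      Avoids132 1 (colState (N + 1) T id) := by
    induction N with
    | zero =>
      have e : colState 0 T id = id := rfl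
      have h0 : Avoids132 1 (colState 0 T id) := by
        intro p q r _ _ h1 _ h2
        simp only [e, id] at h2
        omega
      refine ⟨Function.injective_id, h0, ?_⟩
      have := Avoids132.bubbleSet Set.finite_empty (h.fin 0) (fun v ⟨i, hi⟩ => h.pos _ v hi)
        h.columnStep_zero (f := id) Function.injective_id (by rwa [bubbleSet_empty])
      rwa [bubbleSet_empty] at this
    | succ N ih =>
      obtain ⟨h1, h2, h3⟩ := ih
      refine ⟨?_, h3, ?_⟩
      · rw [colState_succ]
        exact bubbleSet_injective (h.fin N) h1
      · rw [colState_succ, colState_succ]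
        rw [colState_succ] at h3
        exact Avoids132.bubbleSet (h.fin N) (h.fin (N + 1)) (fun v ⟨i, hi⟩ => h.pos _ v hi)
          (h.columnStep_succ N) h1 h3
  exact key.2.1

end minimal

section minTab

variable {θ : Finset (ℕ × ℕ)}

/-- The maximal cardinality of a chain in `θ` with greatest element `α`. -/
def chainHeight (θ : Finset (ℕ × ℕ)) (α : ℕ × ℕ) : ℕ :=
  sSup {n : ℕ | ∃ s : Finset (ℕ × ℕ), (s : Set (ℕ × ℕ)) ⊆ (θ : Set (ℕ × ℕ)) ∧
      (∀ a ∈ s, ∀ b ∈ s, a ≤ b ∨ b ≤ a) ∧ α ∈ s ∧ (∀ a ∈ s, a ≤ α) ∧ s.card = n}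

theorem minTab_eq (θ : Finset (ℕ × ℕ)) (α : ℕ × ℕ) :
    minTab θ α = if α ∈ θ then some (chainHeight θ α : ℤ) else none := by
  unfold minTab chainHeight
  split_ifs <;> rfl

theorem minTab_ne_none_iff {α : ℕ × ℕ} : minTab θ α ≠ none ↔ α ∈ θ := by
  simp [minTab_eq]

theorem minTab_eq_some_iff {α : ℕ × ℕ} {v : ℤ} :
    minTab θ α = some v ↔ α ∈ θ ∧ (chainHeight θ α : ℤ) = v := by
  rw [minTab_eq]
  split_ifs with h <;> simp [h]

theorem card_le_chainHeight {α : ℕ × ℕ} {s : Finset (ℕ × ℕ)} (h1 : s ⊆ θ)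
    (h2 : ∀ a ∈ s, ∀ b ∈ s, a ≤ b ∨ b ≤ a) (h3 : α ∈ s) (h4 : ∀ a ∈ s, a ≤ α) :
    s.card ≤ chainHeight θ α := by
  refine le_csSup ⟨θ.card, ?_⟩ ⟨s, by exact_mod_cast h1, h2, h3, h4, rfl⟩
  rintro n ⟨s', h, -, -, -, rfl⟩
  exact Finset.card_le_card (by exact_mod_cast h)

theorem exists_card_eq_chainHeight {α : ℕ × ℕ} (h : α ∈ θ) :
    ∃ s : Finset (ℕ × ℕ), s ⊆ θ ∧ (∀ a ∈ s, ∀ b ∈ s, a ≤ b ∨ b ≤ a) ∧ α ∈ s ∧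
      (∀ a ∈ s, a ≤ α) ∧ s.card = chainHeight θ α := by
  obtain ⟨s, h1, h2⟩ := Nat.sSup_mem (s := {n : ℕ | ∃ s : Finset (ℕ × ℕ),
      (s : Set (ℕ × ℕ)) ⊆ (θ : Set (ℕ × ℕ)) ∧
      (∀ a ∈ s, ∀ b ∈ s, a ≤ b ∨ b ≤ a) ∧ α ∈ s ∧ (∀ a ∈ s, a ≤ α) ∧ s.card = n})
    ⟨1, {α}, by simpa using h, by simp, by simp, by simp, by simp⟩
    ⟨θ.card, by
      rintro n ⟨s', h, -, -, -, rfl⟩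
      exact Finset.card_le_card (by exact_mod_cast h)⟩
  exact ⟨s, by exact_mod_cast h1, h2⟩

theorem chainHeight_pos {α : ℕ × ℕ} (h : α ∈ θ) : 1 ≤ chainHeight θ α := by
  simpa using card_le_chainHeight (θ := θ) (α := α) (s := {α}) (by simpa using h) (by simp)
    (by simp) (by simp)

theorem chainHeight_lt {α β : ℕ × ℕ} (hα : α ∈ θ) (hβ : β ∈ θ) (h : α < β) :
    chainHeight θ α < chainHeight θ β := by
  obtain ⟨s, h1, h2, h3, h4, h5⟩ := exists_card_eq_chainHeight hα
  have hβs : β ∉ s := fun hb => (h4 β hb).not_gt h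
  have hle : ∀ a ∈ s, a ≤ β := fun a ha => (h4 a ha).trans h.le
  have := card_le_chainHeight (θ := θ) (α := β) (s := insert β s) (Finset.insert_subset hβ h1)
    (by
      intro a ha b hb
      rw [Finset.mem_insert] at ha hb
      rcases ha with rfl | ha <;> rcases hb with rfl | hb
      · exact Or.inl le_rfl
      · exact Or.inr (hle b hb)
      · exact Or.inl (hle a ha)
      · exact h2 a ha b hb)
    (Finset.mem_insert_self _ _)
    (by
      intro a ha
      rcases Finset.mem_insert.1 ha with rfl | ha
      · exact le_rfl
      · exact hle a ha)
  rw [Finset.card_insert_of_notMem hβs] at this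
  omega

theorem exists_chainHeight_add_one {α : ℕ × ℕ} (hα : α ∈ θ) (h : 2 ≤ chainHeight θ α) :
    ∃ γ ∈ θ, γ < α ∧ chainHeight θ γ + 1 = chainHeight θ α := by
  obtain ⟨s, h1, h2, h3, h4, h5⟩ := exists_card_eq_chainHeight hα
  have hcard := Finset.card_erase_of_mem h3
  have hne : (s.erase α).Nonempty := by
    rw [← Finset.card_pos]; omega
  obtain ⟨γ, hγ, hmax⟩ := (s.erase α).exists_maximal hne
  obtain ⟨hγα, hγs⟩ := Finset.mem_erase.1 hγ
  have hlt : γ < α := lt_of_le_of_ne (h4 γ hγs) hγα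
  refine ⟨γ, h1 hγs, hlt, ?_⟩
  have h6 := chainHeight_lt (h1 hγs) hα hlt
  have h7 := card_le_chainHeight (θ := θ) (α := γ) (s := s.erase α)
    ((Finset.erase_subset _ _).trans h1)
    (fun a ha b hb => h2 a (Finset.mem_of_mem_erase ha) b (Finset.mem_of_mem_erase hb)) hγ
    (fun a ha => by
      rcases h2 a (Finset.mem_of_mem_erase ha) γ hγs with h' | h'
      · exact h'
      · exact hmax ha h')
  omega

theorem exists_le_pred_of_lt {i j i' j' : ℕ} (h : (i', j') < (i, j)) :
    (∃ x, i = x + 1 ∧ (i', j') ≤ (x, j)) ∨ (∃ y, j = y + 1 ∧ (i', j') ≤ (i, y)) := by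
  simp only [Prod.mk_lt_mk, Prod.mk_le_mk] at *
  rcases h with h | h
  · exact Or.inl ⟨i - 1, by omega, by omega, by omega⟩
  · exact Or.inr ⟨j - 1, by omega, by omega, by omega⟩

theorem isMinimal_minTab (hc : ∀ a b c, a ≤ b → b ≤ c → a ∈ θ → c ∈ θ → b ∈ θ) :
    IsMinimal (minTab θ) where
  fin j := by
    refine (θ.finite_toSet.image fun p => (chainHeight θ p : ℤ)).subset ?_
    rintro v ⟨i, hi⟩
    rw [minTab_eq_some_iff] at hi
    exact ⟨_, hi⟩
  convex a b c := by
    simp only [minTab_ne_none_iff]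
    exact hc a b c
  inc a b hab x y hx hy := by
    rw [minTab_eq_some_iff] at hx hy
    rw [← hx.2, ← hy.2]
    exact_mod_cast chainHeight_lt hx.1 hy.1 hab
  pos p v h := by
    rw [minTab_eq_some_iff] at h
    rw [← h.2]
    exact_mod_cast chainHeight_pos h.1
  pred i j k h hk := by
    simp only [minTab_eq_some_iff] at *
    obtain ⟨hα, rfl⟩ := h
    obtain ⟨⟨i', j'⟩, hγ, hlt, he⟩ := exists_chainHeight_add_one hα (by exact_mod_cast hk)
    have key : ∀ c : ℕ × ℕ, (i', j') ≤ c → c < (i, j) →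
        c ∈ θ ∧ (chainHeight θ c : ℤ) = chainHeight θ (i, j) - 1 := by
      intro c h1 h2
      have hcθ : c ∈ θ := hc _ _ _ h1 h2.le hγ hα
      rcases h1.eq_or_lt with rfl | h3
      · exact ⟨hcθ, by omega⟩
      · have := chainHeight_lt hγ hcθ h3
        have := chainHeight_lt hcθ hα h2
        omega
    rcases exists_le_pred_of_lt hlt with ⟨x, rfl, h1⟩ | ⟨y, rfl, h1⟩
    · exact Or.inl ⟨x, rfl, key _ h1 (by simp)⟩
    · exact Or.inr ⟨y, rfl, key _ h1 (by simp)⟩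

/-- The minimal tableau of a straight shape has entry `i + j + 1` in the box `(i, j)`. -/
theorem minTab_eq_of_straightShape (hθ : StraightShape θ) {i j : ℕ} {v : ℤ}
    (h : minTab θ (i, j) = some v) : v = 1 + i + j := by
  have hm : IsMinimal (minTab θ) := isMinimal_minTab fun a b c _ hbc _ hc => hθ c hc b hbc
  induction hn : i + j generalizing i j v with
  | zero =>
    obtain ⟨rfl, rfl⟩ : i = 0 ∧ j = 0 := by omega
    have h1 := hm.pos _ _ h
    by_contra hne
    rcases hm.pred 0 0 v h (by simp at hne; omega) with ⟨_, h2, -⟩ | ⟨_, h2, -⟩ <;> omega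
  | succ n ih =>
    have h1 := hm.pos _ _ h
    have hmem : ∀ q : ℕ × ℕ, q < (i, j) → 2 ≤ v := by
      intro q hq
      have : q ∈ θ := hθ _ (minTab_ne_none_iff.1 (by simp [h])) q hq.le
      obtain ⟨w, hw⟩ := Option.ne_none_iff_exists'.1 (minTab_ne_none_iff.2 this)
      have h2 := hm.pos _ _ hw
      have h3 := hm.inc _ _ hq _ _ hw h
      omega
    have h2 : 2 ≤ v := hmem (0, 0) (by simp only [Prod.mk_lt_mk]; omega)
    rcases hm.pred i j v h h2 with ⟨i', rfl, h3⟩ | ⟨j', rfl, h3⟩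
    · have := ih h3 (by omega)
      push_cast; omega
    · have := ih h3 (by omega)
      push_cast; omega

end minTab

section unique

/-- The action of an interval of positions on a function increasing there is a cyclic shift. -/
theorem bubbleSet_Ico {d t : ℤ} (hdt : d ≤ t) {f : ℤ → ℤ} (hf : ∀ p, d ≤ p → p < t → f p < f (p + 1))
    (p : ℤ) : bubbleSet (Set.Ico d t) f p =
      if p = d then f t else if d < p ∧ p ≤ t then f (p - 1) else f p := by
  have hfin : (Set.Ico d t).Finite := Set.finite_Ico d t
  have key : ∀ n : ℕ, d ≤ t - n → bubbleSet (Set.Ico d t ∩ Set.Ici (t - n)) f =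
      fun p => if p = t - n then f t else if t - n < p ∧ p ≤ t then f (p - 1) else f p := by
    intro n
    induction n with
    | zero =>
      intro _
      have : Set.Ico d t ∩ Set.Ici (t - (0 : ℕ)) = ∅ := by
        ext v; simp
      rw [this, bubbleSet_empty]
      funext p
      simp only [Nat.cast_zero, sub_zero]
      split_ifs with h h'
      · rw [h]
      · omega
      · rfl
    | succ n ih =>
      intro h
      push_cast at h ⊢
      have hmono : f (t - (n + 1)) < f t := by
        have : ∀ m : ℕ, m ≤ n → f (t - (n + 1)) < f (t - (n + 1) + (m + 1)) := by
          intro m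
          induction m with
          | zero => intro _; simpa using hf (t - (n + 1)) h (by omega)
          | succ m ihm =>
            intro hm
            have h1 := ihm (by omega)
            have h2 := hf (t - (n + 1) + (m + 1)) (by omega) (by omega)
            push_cast
            rw [← add_assoc] at h2 ⊢
            rw [add_assoc, add_assoc] at *
            exact h1.trans h2
        have := this n le_rfl
        rwa [sub_add_cancel] at this
      have e : t - (n + 1 : ℤ) + 1 = t - n := by ring
      rw [bubbleSet_inter_Ici hfin, if_pos ⟨h, by omega⟩, e, ih (by omega)]
      funext p
      simp only [bubble, e]
      grind
  have := key (t - d).toNat (by omega)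
  rw [show t - ((t - d).toNat : ℤ) = d by omega] at this
  have e : Set.Ico d t ∩ Set.Ici d = Set.Ico d t := Set.inter_eq_left.2 fun v hv => hv.1
  rw [e] at this
  rw [this]

/-- Acting at positions at least `d` preserves an inversion at such positions. -/
theorem inversion_bubble {d k X Y : ℤ} (hk : d ≤ k) (hXY : X < Y) {f : ℤ → ℤ}
    (h : ∃ q r, d ≤ q ∧ q < r ∧ f q = Y ∧ f r = X) :
    ∃ q r, d ≤ q ∧ q < r ∧ bubble k f q = Y ∧ bubble k f r = X := by
  obtain ⟨q, r, h1, h2, h3, h4⟩ := h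
  by_cases hlt : f k < f (k + 1)
  · refine ⟨if q = k then k + 1 else if q = k + 1 then k else q,
      if r = k then k + 1 else if r = k + 1 then k else r, ?_, ?_, ?_, ?_⟩
    · grind
    · grind
    · simp only [bubble]; grind
    · simp only [bubble]; grind
  · refine ⟨q, r, h1, h2, ?_, ?_⟩
    · simp only [bubble]; grind
    · simp only [bubble]; grind

theorem colState_induction {T : ℕ × ℕ → Option ℤ} (hfin : ∀ j, (tabCol T j).Finite)
    {P : (ℤ → ℤ) → Prop} {f : ℤ → ℤ} (h0 : P f)
    (h1 : ∀ p t, T p = some t → ∀ f', P f' → P (bubble t f')) (N : ℕ) : P (colState N T f) := by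
  induction N with
  | zero => exact h0
  | succ N ih =>
    rw [colState_succ]
    exact bubbleSet_induction (hfin N) ih fun t ⟨i, hi⟩ => h1 _ t hi

/-- The first column of a straight increasing tableau whose word produces no pattern `132`. -/
theorem first_column_eq {T : ℕ × ℕ → Option ℤ} {S : Set ℤ} (hS : S.Finite)
    (hfin : ∀ j, (tabCol T j).Finite) {d : ℤ} (hSd : ∀ v ∈ S, d ≤ v)
    (hTd : ∀ p v, T p = some v → d + 1 ≤ v) {f : ℤ → ℤ}
    (hf : ∀ p q, d ≤ p → p < q → f p < f q) (N : ℕ)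
    (ha : Avoids132 d (colState N T (bubbleSet S f))) :
    ∃ t, d ≤ t ∧ S = Set.Ico d t ∧ colState N T (bubbleSet S f) d = f t := by
  obtain ⟨t, ⟨htd, htS⟩, hmin⟩ : ∃ t, (d ≤ t ∧ t ∉ S) ∧ ∀ s, d ≤ s → s < t → s ∈ S := by
    have hex : ∃ n : ℕ, d + n ∉ S := by
      obtain ⟨b, hb⟩ := hS.bddAbove
      refine ⟨(b + 1 - d).toNat, fun h => ?_⟩
      have := hb h
      omega
    refine ⟨d + Nat.find hex, ⟨by omega, Nat.find_spec hex⟩, fun s hs hst => ?_⟩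
    have := Nat.find_min hex (m := (s - d).toNat) (by omega)
    rw [not_not, show d + ((s - d).toNat : ℤ) = s by omega] at this
    exact this
  have hIco : S ∩ Set.Iio t = Set.Ico d t := by
    ext v
    simp only [Set.mem_inter_iff, Set.mem_Iio, Set.mem_Ico]
    exact ⟨fun h => ⟨hSd v h.1, h.2⟩, fun h => ⟨hmin v h.1 h.2, h.2⟩⟩
  have hlow : ∀ p, p ≤ t → bubbleSet (S ∩ Set.Ici t) f p = f p := by
    intro p hp
    rw [bubbleSet_inter_Ici hS, if_neg htS]
    exact bubbleSet_inter_Ici_of_lt hS (by omega) f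
  have hd1 : bubbleSet S f d = f t := by
    rw [bubbleSet_split hS t, hIco, bubbleSet_Ico htd, if_pos rfl, hlow t le_rfl]
    intro p hp hpt
    rw [hlow p (by omega), hlow (p + 1) (by omega)]
    exact hf _ _ hp (by omega)
  have hd : colState N T (bubbleSet S f) d = f t := by
    refine colState_induction hfin (P := fun f' => f' d = f t) hd1 ?_ N
    intro p s hs f' hf'
    have := hTd p s hs
    simp only [bubble]
    rw [if_neg (by omega), if_neg (by omega), hf']
  refine ⟨t, htd, ?_, hd⟩
  rw [← hIco, eq_comm, Set.inter_eq_left]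
  intro v hv
  by_contra hvt
  have hvt : t < v := by
    rcases (not_lt.1 (show ¬ v < t from hvt)).eq_or_lt with h | h
    · exact absurd (h ▸ hv) htS
    · exact h
  obtain ⟨m, hm, hmax⟩ := hS.exists_maximal ⟨v, hv⟩
  have hmax' : ∀ w ∈ S, w ≤ m := fun w hw => by
    by_contra h
    exact h (hmax hw (by omega))
  have hvm := hmax' v hv
  have hSm : S ∩ Set.Ici (m + 1) = ∅ := by
    ext w
    simp only [Set.mem_inter_iff, Set.mem_Ici, Set.mem_empty_iff_false, iff_false, not_and, not_le]
    intro hw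
    have := hmax' w hw
    omega
  have hXY : f m < f (m + 1) := hf _ _ (by omega) (by omega)
  have h1 : ∃ q r, d ≤ q ∧ q < r ∧ bubbleSet (S ∩ Set.Ici m) f q = f (m + 1) ∧
      bubbleSet (S ∩ Set.Ici m) f r = f m := by
    refine ⟨m, m + 1, by omega, by omega, ?_, ?_⟩ <;>
      rw [bubbleSet_inter_Ici hS, if_pos hm, hSm, bubbleSet_empty] <;> simp [bubble] <;> omega
  have h2 : ∃ q r, d ≤ q ∧ q < r ∧ bubbleSet S f q = f (m + 1) ∧ bubbleSet S f r = f m := by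
    rw [bubbleSet_split hS m]
    exact bubbleSet_induction (hS.inter_of_left _)
      (P := fun f' => ∃ q r, d ≤ q ∧ q < r ∧ f' q = f (m + 1) ∧ f' r = f m) h1
      fun s hs f' => inversion_bubble (hSd s hs.1) hXY
  obtain ⟨q, r, hq, hqr, hfq, hfr⟩ := colState_induction hfin
    (P := fun f' => ∃ q r, d ≤ q ∧ q < r ∧ f' q = f (m + 1) ∧ f' r = f m) h2
    (fun p s hs f' => inversion_bubble (by have := hTd p s hs; omega) hXY) N
  have htm : f t < f m := hf _ _ htd (by omega)
  have hqd : q ≠ d := by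
    rintro rfl
    rw [hd] at hfq
    omega
  exact ha d q r le_rfl (by omega) hqr (by rw [hd, hfr]; exact htm) (by rw [hfr, hfq]; exact hXY)

theorem entry_eq_of_tabCol_eq_Ico {U : ℕ × ℕ → Option ℤ}
    (hs : ∀ p, U p ≠ none → ∀ q ≤ p, U q ≠ none) (hi : Increasing U) {j : ℕ} {d t : ℤ}
    (h : tabCol U j = Set.Ico d t) (i : ℕ) :
    U (i, j) = if d + i < t then some (d + i) else none := by
  have hmem : ∀ i v, U (i, j) = some v → d ≤ v ∧ v < t := by
    intro i v hv
    have : v ∈ tabCol U j := ⟨i, hv⟩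
    rwa [h] at this
  have hinj : ∀ i i' v, U (i, j) = some v → U (i', j) = some v → ¬ i < i' := by
    intro i i' v h1 h2 hlt
    have := hi (i, j) (i', j) (by simpa using hlt) _ _ h1 h2
    omega
  have key : ∀ i : ℕ, d + i < t → U (i, j) = some (d + i) := by
    intro i
    induction i using Nat.strong_induction_on with
    | _ i ih =>
      intro hit
      obtain ⟨i', hi'⟩ : d + (i : ℤ) ∈ tabCol U j := by
        rw [h]; exact ⟨by omega, hit⟩
      rcases lt_trichotomy i' i with h' | rfl | h'
      · have := ih i' h' (by omega)
        rw [hi'] at this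
        simp at this
        omega
      · exact hi'
      · obtain ⟨w, hw⟩ := Option.ne_none_iff_exists'.1
          (hs (i', j) (by simp [hi']) (i, j) (by simpa using h'.le))
        have h1 := hmem _ _ hw
        have h2 := hi (i, j) (i', j) (by simpa using h') _ _ hw hi'
        have h3 := ih (w - d).toNat (by omega) (by omega)
        rw [show d + ((w - d).toNat : ℤ) = w by omega] at h3
        exact (hinj _ _ _ h3 hw (by omega)).elim
  split_ifs with hit
  · exact key i hit
  · by_contra hne
    obtain ⟨w, hw⟩ := Option.ne_none_iff_exists'.1 hne
    have h1 := hmem _ _ hw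
    have h3 := key (w - d).toNat (by omega)
    rw [show d + ((w - d).toNat : ℤ) = w by omega] at h3
    exact hinj _ _ _ h3 hw (by omega)

theorem straight_tableau_unique (N : ℕ) {U V : ℕ × ℕ → Option ℤ} {d : ℤ} {f : ℤ → ℤ}
    (hf : ∀ p q, d ≤ p → p < q → f p < f q)
    (hUs : ∀ p, U p ≠ none → ∀ q ≤ p, U q ≠ none) (hVs : ∀ p, V p ≠ none → ∀ q ≤ p, V q ≠ none)
    (hUi : Increasing U) (hVi : Increasing V) (hUf : ∀ j, (tabCol U j).Finite)
    (hVf : ∀ j, (tabCol V j).Finite) (hUd : ∀ p v, U p = some v → d ≤ v)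
    (hVd : ∀ p v, V p = some v → d ≤ v) (hUV : colState N U f = colState N V f)
    (ha : Avoids132 d (colState N U f)) :
    ∀ j < N, ∀ i : ℕ, U (i, j) = V (i, j) ∧ ∀ v, U (i, j) = some v → v = d + i + j := by
  induction N generalizing U V d f with
  | zero => intro j hj; omega
  | succ N ih =>
    have shift_s : ∀ {W : ℕ × ℕ → Option ℤ}, (∀ p, W p ≠ none → ∀ q ≤ p, W q ≠ none) →
        ∀ p : ℕ × ℕ, W (p.1, p.2 + 1) ≠ none → ∀ q ≤ p, W (q.1, q.2 + 1) ≠ none := by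
      intro W h p hp q hq
      refine h _ hp _ ?_
      exact ⟨hq.1, by simpa using hq.2⟩
    have shift_i : ∀ {W : ℕ × ℕ → Option ℤ}, Increasing W →
        Increasing fun p : ℕ × ℕ => W (p.1, p.2 + 1) := by
      rintro W h ⟨i, j⟩ ⟨i', j'⟩ hlt x y hx hy
      refine h _ _ ?_ x y hx hy
      simp only [Prod.mk_lt_mk] at hlt ⊢
      omega
    have shift_d : ∀ {W : ℕ × ℕ → Option ℤ}, (∀ p, W p ≠ none → ∀ q ≤ p, W q ≠ none) →
        Increasing W → (∀ p v, W p = some v → d ≤ v) →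
        ∀ (p : ℕ × ℕ) v, W (p.1, p.2 + 1) = some v → d + 1 ≤ v := by
      intro W h hi hd p v hv
      obtain ⟨w, hw⟩ := Option.ne_none_iff_exists'.1 
        (h (p.1, p.2 + 1) (by simp [hv]) (p.1, p.2) ⟨le_rfl, Nat.le_succ _⟩)
      have h1 := hd _ _ hw
      have h2 := hi (p.1, p.2) (p.1, p.2 + 1) (Prod.mk_lt_mk.2 (by omega)) _ _ hw hv
      omega
    rw [colState_succ'] at hUV ha
    have ha' := ha
    rw [hUV] at ha'
    rw [colState_succ'] at hUV ha'
    obtain ⟨t, htd, hUt, hUe⟩ := first_column_eq (hUf 0) (fun j => hUf (j + 1))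
      (fun v ⟨i, hi⟩ => hUd _ v hi) (shift_d hUs hUi hUd) hf N ha
    obtain ⟨t', htd', hVt, hVe⟩ := first_column_eq (hVf 0) (fun j => hVf (j + 1))
      (fun v ⟨i, hi⟩ => hVd _ v hi) (shift_d hVs hVi hVd) hf N ha'
    obtain rfl : t = t' := by
      rw [hUV, hVe] at hUe
      rcases lt_trichotomy t t' with h | h | h
      · have := hf _ _ htd h; omega
      · exact h
      · have := hf _ _ htd' h; omega
    rw [hVt, ← hUt] at hUV
    have hf' : ∀ p q, d + 1 ≤ p → p < q →
        bubbleSet (tabCol U 0) f p < bubbleSet (tabCol U 0) f q := by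
      intro p q hp hpq
      rw [hUt, bubbleSet_Ico htd fun p hp _ => hf _ _ hp (by omega),
        bubbleSet_Ico htd fun p hp _ => hf _ _ hp (by omega)]
      split_ifs <;> first | omega | exact hf _ _ (by omega) (by omega)
    have hrec := ih hf' (shift_s hUs) (shift_s hVs) (shift_i hUi) (shift_i hVi)
      (fun j => hUf (j + 1)) (fun j => hVf (j + 1)) (shift_d hUs hUi hUd) (shift_d hVs hVi hVd)
      hUV (fun p q r hp => ha p q r (by omega))
    intro j hj i
    rcases j with _ | j
    · have e1 := entry_eq_of_tabCol_eq_Ico hUs hUi hUt i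
      have e2 := entry_eq_of_tabCol_eq_Ico hVs hVi hVt i
      refine ⟨by rw [e1, e2], fun v hv => ?_⟩
      rw [e1] at hv
      split_ifs at hv
      simp at hv
      push_cast
      omega
    · obtain ⟨h1, h2⟩ := hrec j (by omega) i
      refine ⟨h1, fun v hv => ?_⟩
      have := h2 v hv
      push_cast
      omega

end unique


theorem minimal_skew_tableau_unique_rectification
    (lam nu : Finset (ℕ × ℕ)) (hl : StraightShape lam) (hn : StraightShape nu)
    (hln : lam ⊆ nu) :
    ∃ R : ℕ × ℕ → Option ℤ,
      RectifiesTo (minTab (nu \ lam)) R ∧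
      (∀ R' : ℕ × ℕ → Option ℤ, RectifiesTo (minTab (nu \ lam)) R' → R' = R) ∧
      ∃ mu : Finset (ℕ × ℕ), StraightShape mu ∧ R = minTab mu := by
  have hM : IsMinimal (minTab (nu \ lam)) := by
    refine isMinimal_minTab fun a b c hab hbc ha hc => ?_
    rw [Finset.mem_sdiff] at *
    exact ⟨hn c hc.1 b hbc, fun hb => ha.2 (hl b hb a hab)⟩
  have hs : shapeOf (minTab (nu \ lam)) = (nu : Set (ℕ × ℕ)) \ lam := by
    ext p
    simp [shapeOf, minTab_eq]
  have key : ∀ U V, RectifiesTo (minTab (nu \ lam)) U → RectifiesTo (minTab (nu \ lam)) V →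
      ∀ i j : ℕ, U (i, j) = V (i, j) ∧ ∀ v, U (i, j) = some v → v = 1 + i + j := by
    rintro U V ⟨hU, mu, hmu, hmuU⟩ ⟨hV, mu', hmu', hmuV⟩ i j
    obtain ⟨hUi, hUv, hUw⟩ := forwardSlides_spec hU hM.inc
    obtain ⟨hVi, hVv, hVw⟩ := forwardSlides_spec hV hM.inc
    obtain ⟨N, hN1, hN2, hN3⟩ := ((hUw bubbleOp_heckeRel).and
      ((hVw bubbleOp_heckeRel).and (Filter.eventually_gt_atTop j))).exists
    have straight : ∀ {W : ℕ × ℕ → Option ℤ} {m : Finset (ℕ × ℕ)}, StraightShape m →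
        shapeOf W = m → ∀ p, W p ≠ none → ∀ q ≤ p, W q ≠ none := by
      intro W m hm hW p hp q hq
      have h1 : p ∈ shapeOf W := hp
      have h2 : q ∈ shapeOf W := by
        rw [hW] at h1 ⊢
        exact hm p h1 q hq
      exact h2
    have finite : ∀ {W : ℕ × ℕ → Option ℤ} {m : Finset (ℕ × ℕ)},
        shapeOf W = m → ∀ j, (tabCol W j).Finite := by
      intro W m hW j
      refine (m.finite_toSet.image fun p => (W p).getD 0).subset ?_
      rintro v ⟨i, hi⟩
      refine ⟨(i, j), ?_, by simp [hi]⟩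
      rw [← hW]
      simp [shapeOf, hi]
    have eU : colState N U id = colState N (minTab (nu \ lam)) id := by
      rw [colState, hN1, colState]
    have eV : colState N V id = colState N (minTab (nu \ lam)) id := by
      rw [colState, hN2, colState]
    refine straight_tableau_unique N (U := U) (V := V) (d := 1) (f := id)
      (fun p q _ h => h) (straight hmu hmuU) (straight hmu' hmuV) hUi hVi (finite hmuU)
      (finite hmuV) (fun p v h => ?_) (fun p v h => ?_) (eU.trans eV.symm) ?_ j hN3 i
    · obtain ⟨q, hq⟩ := hUv p v h
      exact hM.pos q v hq
    · obtain ⟨q, hq⟩ := hVv p v h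
      exact hM.pos q v hq
    · rw [eU]
      exact hM.avoids132 N
  obtain ⟨R, hR⟩ := exists_rectification hM.inc ⟨hl, hn, hln⟩ hs
  refine ⟨R, hR, fun R' hR' => funext fun p => (key R' R hR' hR p.1 p.2).1, ?_⟩
  obtain ⟨mu, hmu, hshape⟩ := hR.2
  refine ⟨mu, hmu, funext fun ⟨i, j⟩ => ?_⟩
  have hmem : R (i, j) ≠ none ↔ (i, j) ∈ mu := by
    have : (i, j) ∈ shapeOf R ↔ (i, j) ∈ (mu : Set (ℕ × ℕ)) := by rw [hshape]
    exact this
  by_cases hij : (i, j) ∈ mu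
  · obtain ⟨v, hv⟩ := Option.ne_none_iff_exists'.1 (hmem.2 hij)
    obtain ⟨w, hw⟩ := Option.ne_none_iff_exists'.1 (minTab_ne_none_iff.2 hij)
    rw [hv, hw, (key R R hR hR i j).2 v hv, minTab_eq_of_straightShape hmu hw]
  · rw [not_not.1 (mt hmem.1 hij), not_not.1 (mt minTab_ne_none_iff.1 hij)]
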